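/- arXiv:1908.00665 — 4 statements merged into one kernel-verified Lean document; each statement's English description precedes it below -/
import Mathlib

section
/- Let G be a 2-connected graph and u a vertex of G such that every vertex other than u has degree at least h ≥ 2. Then G contains a path with min(|V(G)|, 2h) vertices having u as an endpoint. -/
open SimpleGraph

/-- `G` embeds into `H` as a (not necessarily induced) subgraph. -/
def SubgraphOf {V W : Type*} (G : SimpleGraph V) (H : SimpleGraph W) : Prop :=
  ∃ f : V ↪ W, ∀ a b, G.Adj a b → H.Adj (f a) (f b)

/-- `G` contains a linear forest consisting of pairwise vertex-disjoint paths
with orders `L i` (`i : ι`). -/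
def ContainsForest {V ι : Type*} (G : SimpleGraph V) (L : ι → ℕ) : Prop :=
  ∃ f : ∀ i, Fin (L i) → V,
    (∀ i, Function.Injective (f i)) ∧
    (∀ i j, i ≠ j → ∀ a b, f i a ≠ f j b) ∧
    (∀ i (a : ℕ) (ha : a + 1 < L i), G.Adj (f i ⟨a, by omega⟩) (f i ⟨a + 1, ha⟩))

/-- `G` is 2-connected: more than 2 vertices and removing fewer than 2 vertices
leaves a connected graph. -/
def TwoConnected {V : Type*} [Fintype V] (G : SimpleGraph V) : Prop :=
  2 < Fintype.card V ∧
    ∀ s : Finset V, s.card < 2 → (G.induce ((s : Set V)ᶜ)).Connected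

/-- `S_{n,h} = K_h ∨ \overline{K_{n-h}}`. -/
def Sgraph (n h : ℕ) : SimpleGraph (Fin n) :=
  SimpleGraph.fromRel (fun a _ => a.val < h)

/-- `S⁺_{n,h} = K_h ∨ (K_2 ∪ \overline{K_{n-h-2}})`, the extra edge joining vertices `h` and `h+1`. -/
def SplusGraph (n h : ℕ) : SimpleGraph (Fin n) :=
  SimpleGraph.fromRel (fun a b => a.val < h ∨ (a.val ≤ h + 1 ∧ b.val ≤ h + 1))

/-- index of the clique block containing vertex `v ≥ 1` in `K_1 ∨ (t₁ K_h ∪ t₂ K_{h+1})`. -/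
def blockIdx (t₁ h v : ℕ) : ℕ :=
  if v - 1 < t₁ * h then (v - 1) / h else t₁ + (v - 1 - t₁ * h) / (h + 1)

/-- `L_{t₁,t₂,h,h+1} = K_1 ∨ (t₁ K_h ∪ t₂ K_{h+1})`; vertex `0` is the center. -/
def Lgen (t₁ t₂ h : ℕ) : SimpleGraph (Fin (t₁ * h + t₂ * (h + 1) + 1)) :=
  SimpleGraph.fromRel (fun a b =>
    a.val = 0 ∨ blockIdx t₁ h a.val = blockIdx t₁ h b.val)

/-- `U_{3,h}`: three copies of `K_{h+1}` plus a triangle on one chosen vertex of each. -/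
def Ugraph (h : ℕ) : SimpleGraph (Fin (3 * (h + 1))) :=
  SimpleGraph.fromRel (fun a b =>
    a.val / (h + 1) = b.val / (h + 1) ∨ (a.val % (h + 1) = 0 ∧ b.val % (h + 1) = 0))

/-- `K_p ∨ (m K_2)`: a clique on the first `p` vertices joined to `m` disjoint edges. -/
def KjoinMK2 (p m : ℕ) : SimpleGraph (Fin (p + 2 * m)) :=
  SimpleGraph.fromRel (fun a b => a.val < p ∨ (a.val - p) / 2 = (b.val - p) / 2)

/-- `F_{t₁,t₂,h,h+1}`: `L_{t₁,t₂,h,h+1}` plus one extra `K_{h+1}` joined to the center by an edge. -/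
def Fgraph (t₁ t₂ h : ℕ) : SimpleGraph (Fin (t₁ * h + (t₂ + 1) * (h + 1) + 1)) :=
  SimpleGraph.fromRel (fun a b =>
    (a.val < t₁ * h + t₂ * (h + 1) + 1 ∧ b.val < t₁ * h + t₂ * (h + 1) + 1 ∧
      (a.val = 0 ∨ blockIdx t₁ h a.val = blockIdx t₁ h b.val)) ∨
    (t₁ * h + t₂ * (h + 1) + 1 ≤ a.val ∧ t₁ * h + t₂ * (h + 1) + 1 ≤ b.val) ∨
    (a.val = 0 ∧ b.val = t₁ * h + t₂ * (h + 1) + 1))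

/-- `T_{t₁,t₂,h,h+1}`: `L_{t₁,t₂,h,h+1}` plus two extra `K_{h+1}`'s, each joined to the center by an edge. -/
def Tgraph (t₁ t₂ h : ℕ) : SimpleGraph (Fin (t₁ * h + (t₂ + 2) * (h + 1) + 1)) :=
  SimpleGraph.fromRel (fun a b =>
    (a.val < t₁ * h + t₂ * (h + 1) + 1 ∧ b.val < t₁ * h + t₂ * (h + 1) + 1 ∧
      (a.val = 0 ∨ blockIdx t₁ h a.val = blockIdx t₁ h b.val)) ∨
    (t₁ * h + t₂ * (h + 1) + 1 ≤ a.val ∧ a.val < t₁ * h + (t₂ + 1) * (h + 1) + 1 ∧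
      t₁ * h + t₂ * (h + 1) + 1 ≤ b.val ∧ b.val < t₁ * h + (t₂ + 1) * (h + 1) + 1) ∨
    (t₁ * h + (t₂ + 1) * (h + 1) + 1 ≤ a.val ∧ t₁ * h + (t₂ + 1) * (h + 1) + 1 ≤ b.val) ∨
    (a.val = 0 ∧ b.val = t₁ * h + t₂ * (h + 1) + 1) ∨
    (a.val = 0 ∧ b.val = t₁ * h + (t₂ + 1) * (h + 1) + 1))

/-- attach a pendant path with `m` additional vertices at the vertex `u` of `H`
(i.e. identify `u` with an endpoint of `P_{m+1}`). -/
def attachPath {V : Type*} (H : SimpleGraph V) (u : V) (m : ℕ) : SimpleGraph (V ⊕ Fin m) :=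
  SimpleGraph.fromRel (fun a b =>
    (∃ x y, a = Sum.inl x ∧ b = Sum.inl y ∧ H.Adj x y) ∨
    (∃ j : Fin m, a = Sum.inl u ∧ b = Sum.inr j ∧ j.val = 0) ∨
    (∃ i j : Fin m, a = Sum.inr i ∧ b = Sum.inr j ∧ j.val = i.val + 1))

open SimpleGraph

namespace Rooted

variable {V : Type*}

theorem exists_first (p : V → Prop) (l : List V) (h : ∃ v ∈ l, p v) :
    ∃ A b B, l = A ++ b :: B ∧ p b ∧ ∀ v ∈ A, ¬ p v := by
  induction l with
  | nil => simp at h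
  | cons a l ih =>
    by_cases ha : p a
    · exact ⟨[], a, l, by simp [ha]⟩
    · obtain ⟨A, b, B, h1, h2, h3⟩ := ih (by simpa [ha] using h)
      exact ⟨a :: A, b, B, by simp [h1], h2, by simpa [ha] using h3⟩

theorem exists_last (p : V → Prop) (l : List V) (h : ∃ v ∈ l, p v) :
    ∃ A b B, l = A ++ b :: B ∧ p b ∧ ∀ v ∈ B, ¬ p v := by
  obtain ⟨A, b, B, h1, h2, h3⟩ := exists_first p l.reverse (by simpa using h)
  refine ⟨B.reverse, b, A.reverse, ?_, h2, by simpa using h3⟩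
  rw [← List.reverse_reverse l, h1]; simp

theorem chain_rev (G : SimpleGraph V) {l : List V} (h : l.IsChain G.Adj) :
    l.reverse.IsChain G.Adj := by
  rw [List.isChain_reverse]
  exact h.imp (fun _ _ h => h.symm)

theorem conn_path (G : SimpleGraph V) (s : Finset V)
    (hc : (G.induce ((s : Set V)ᶜ)).Connected) (a b : V) (ha : a ∉ s) (hb : b ∉ s) :
    ∃ l : List V, l.IsChain G.Adj ∧ l.Nodup ∧ a ∈ l.head? ∧ b ∈ l.getLast? ∧ ∀ v ∈ l, v ∉ s := by
  obtain ⟨p, hp⟩ := hc.exists_isPath ⟨a, by simpa using ha⟩ ⟨b, by simpa using hb⟩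
  refine ⟨p.support.map Subtype.val, ?_, ?_, ?_, ?_, ?_⟩
  · rw [List.isChain_map]
    exact p.isChain_adj_support
  · exact hp.support_nodup.map Subtype.val_injective
  · rw [List.head?_map, List.head?_eq_some_head p.support_ne_nil, p.head_support]; simp
  · rw [List.getLast?_map, List.getLast?_eq_some_getLast p.support_ne_nil, p.getLast_support]; simp
  · intro v hv
    obtain ⟨x, _, rfl⟩ := List.mem_map.1 hv
    have := x.2
    rwa [Set.mem_compl_iff, Finset.mem_coe] at this

theorem bridge (G : SimpleGraph V) (s : Finset V)
    (hc : (G.induce ((s : Set V)ᶜ)).Connected) (X Y : Set V) (a b : V) (ha : a ∉ s) (hb : b ∉ s)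
    (haX : a ∈ X) (hbY : b ∈ Y) (hXY : ∀ v, v ∈ X → v ∉ Y) :
    ∃ c M y, (c :: (M ++ [y])).IsChain G.Adj ∧ (c :: (M ++ [y])).Nodup ∧
      (∀ v ∈ c :: (M ++ [y]), v ∉ s) ∧ c ∈ X ∧ y ∈ Y ∧ ∀ v ∈ M, v ∉ X ∧ v ∉ Y := by
  obtain ⟨l, h1, h2, h3, h4, h5⟩ := conn_path G s hc a b ha hb
  obtain ⟨A, y, B, rfl, hy, hA⟩ := exists_first (· ∈ Y) l ⟨b, List.mem_of_getLast? h4, hbY⟩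
  have haA : a ∈ A := by
    cases A with
    | nil => simp at h3; subst h3; exact absurd hy (hXY _ haX)
    | cons c A => simp at h3; simp [h3]
  obtain ⟨A1, c, M, rfl, hc, hM⟩ := exists_last (· ∈ X) A ⟨a, haA, haX⟩
  refine ⟨c, M, y, ?_, ?_, ?_, hc, hy, ?_⟩
  · have : A1 ++ c :: M ++ y :: B = A1 ++ ((c :: (M ++ [y])) ++ B) := by simp
    rw [this] at h1
    exact h1.right_of_append.left_of_append
  · have : A1 ++ c :: M ++ y :: B = A1 ++ ((c :: (M ++ [y])) ++ B) := by simp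
    rw [this] at h2
    exact h2.of_append_right.of_append_left
  · intro v hv
    apply h5
    simp at hv ⊢
    tauto
  · intro v hv
    exact ⟨hM v hv, hA v (by simp [hv])⟩

/-- `l` ends in `S` and avoids `L` before its end. -/
def Arr (L S : Set V) (l : List V) : Prop :=
  ∃ A b, l = A ++ [b] ∧ b ∈ S ∧ ∀ v ∈ A, v ∉ L

theorem Arr.suffix {L S : Set V} {A B : List V} {y : V} (h : Arr L S (A ++ y :: B)) :
    Arr L S (y :: B) := by
  obtain ⟨C, b, h1, h2, h3⟩ := h
  rcases List.eq_nil_or_concat (y :: B) with h0 | ⟨D, d, hD⟩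
  · simp at h0
  · rw [List.concat_eq_append] at hD
    rw [hD, ← List.append_assoc] at h1
    have := List.append_inj' h1 rfl
    obtain ⟨h4, h5⟩ := this
    simp at h5
    subst h5
    exact ⟨D, d, hD, h2, fun v hv => h3 v (by rw [← h4]; simp [hv])⟩

theorem Arr.prefix {L S : Set V} {A l : List V} (h : Arr L S l) (hA : ∀ v ∈ A, v ∉ L) :
    Arr L S (A ++ l) := by
  obtain ⟨C, b, rfl, h2, h3⟩ := h
  refine ⟨A ++ C, b, by simp, h2, ?_⟩
  intro v hv
  simp at hv
  rcases hv with hv | hv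
  · exact hA v hv
  · exact h3 v hv

def St (G : SimpleGraph V) (L : Set V) (s z : V) (H : List V) : Prop :=
  ∃ T1 T2 p, (z :: T1).IsChain G.Adj ∧ (p :: T2).IsChain G.Adj ∧ (z :: T1 ++ p :: T2).Nodup ∧
    p ∈ H ∧ (∀ v ∈ T1, v ∉ H) ∧ (∀ v ∈ T2, v ∉ H) ∧
    ((Arr L {s} (z :: T1) ∧ Arr L L (p :: T2)) ∨ (Arr L L (z :: T1) ∧ Arr L {s} (p :: T2)))

theorem St.base (G : SimpleGraph V) (L : Set V) (s : V) (H : List V)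
    (hc : (G.induce ((({s} : Finset V) : Set V)ᶜ)).Connected) (hL : ∃ a, a ∈ L) (hH : H ≠ [])
    (hsL : s ∉ L) (hsH : s ∉ H) (hLH : ∀ v ∈ H, v ∉ L) : St G L s s H := by
  obtain ⟨a, ha⟩ := hL
  obtain ⟨b, hb⟩ := List.exists_mem_of_ne_nil H hH
  obtain ⟨c, M, y, h1, h2, h3, h4, h5, h6⟩ := bridge G {s} hc {v | v ∈ H} L b a
    (by simp; rintro rfl; exact hsH hb) (by simp; rintro rfl; exact hsL ha) hb ha hLH
  refine ⟨[], M ++ [y], c, by simp, h1, ?_, h4, by simp, ?_, Or.inl ⟨?_, ?_⟩⟩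
  · simp only [List.cons_append, List.nil_append]
    rw [List.nodup_cons]
    exact ⟨fun hs => h3 s hs (by simp), h2⟩
  · intro v hv hvH
    simp at hv
    rcases hv with hv | rfl
    · exact (h6 v hv).1 hvH
    · exact hLH _ hvH h5
  · exact ⟨[], s, by simp, rfl, by simp⟩
  · refine ⟨c :: M, y, by simp, h5, ?_⟩
    intro v hv
    simp at hv
    rcases hv with rfl | hv
    · exact hLH _ h4
    · exact (h6 v hv).2

theorem nd_join {X M B : List V} {c y : V} (hX : X.Nodup) (h2 : (c :: (M ++ [y])).Nodup)
    (hB : (y :: B).Nodup) (h : ∀ v ∈ c :: M, v ∉ X ∧ v ∉ y :: B) (hBX : ∀ v ∈ y :: B, v ∉ X) :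
    (X ++ c :: (M ++ y :: B)).Nodup := by
  have h3 : (c :: M).Nodup := by
    have : c :: (M ++ [y]) = (c :: M) ++ [y] := by simp
    rw [this] at h2
    exact h2.of_append_left
  have : X ++ c :: (M ++ y :: B) = X ++ (c :: M ++ y :: B) := by simp
  rw [this]
  refine List.Nodup.append hX (List.Nodup.append h3 hB ?_) ?_
  · intro v hv hv'; exact (h v hv).2 hv'
  · intro v hv hv'
    rcases List.mem_append.1 hv' with hv' | hv'
    · exact (h v hv').1 hv
    · exact hBX v hv' hv

theorem nd_split {X Y : List V} (h : (X ++ Y).Nodup) :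
    X.Nodup ∧ Y.Nodup ∧ ∀ v ∈ X, v ∉ Y :=
  ⟨h.of_append_left, h.of_append_right, fun _ hv hv' => (List.disjoint_of_nodup_append h) hv hv'⟩

theorem chain_join (G : SimpleGraph V) {A B : List V} {y : V} (h1 : (A ++ [y]).IsChain G.Adj)
    (h2 : (y :: B).IsChain G.Adj) : (A ++ y :: B).IsChain G.Adj :=
  List.isChain_split.2 ⟨h1, h2⟩

theorem St.step (G : SimpleGraph V) (L : Set V) (s z w : V) (H : List V)
    (hc : (G.induce ((({w} : Finset V) : Set V)ᶜ)).Connected) (hL : ∃ a, a ∈ L) (hH : H ≠ [])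
    (hzw : G.Adj z w) (hwL : w ∉ L) (hzL : z ∉ L) (hzwH : (z :: w :: H).Nodup)
    (hLH : ∀ v ∈ H, v ∉ L) (h : St G L s z (w :: H)) : St G L s w H := by
  obtain ⟨T1, T2, p, c1, c2, nd, hp, a1, a2, E⟩ := h
  have hzH : z ∉ H := fun h => (List.nodup_cons.1 hzwH).1 (by simp [h])
  have hwH : w ∉ H := fun h => (List.nodup_cons.1 (List.nodup_cons.1 hzwH).2).1 h
  have c1w : (w :: z :: T1).IsChain G.Adj := List.isChain_cons_cons.2 ⟨hzw.symm, c1⟩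
  have Ew : ∀ S, Arr L S (z :: T1) → Arr L S (w :: z :: T1) := fun S hS =>
    hS.prefix (A := [w]) (by simpa using hwL)
  by_cases hpw : p = w
  · subst hpw
    obtain ⟨a, ha⟩ := hL
    obtain ⟨b, hb⟩ := List.exists_mem_of_ne_nil H hH
    obtain ⟨c, M, y, h1, h2, h3, h4, h5, h6⟩ := bridge G {p} hc {v | v ∈ H}
      {v | v ∈ z :: T1 ∨ v ∈ T2 ∨ v ∈ L} b a
      (by simp; rintro rfl; exact hwH hb) (by simp; rintro rfl; exact hwL ha) hb (by simp [ha])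
      (by
        intro v hv hv'
        simp only [Set.mem_ofPred_eq, List.mem_cons] at hv hv'
        rcases hv' with (rfl | hv') | hv' | hv'
        · exact hzH hv
        · exact a1 v hv' (by simp [hv])
        · exact a2 v hv' (by simp [hv])
        · exact hLH v hv hv')
    simp only [Set.mem_ofPred_eq] at h4 h5 h6
    have hcM : ∀ v ∈ c :: M, v ∉ L := by
      intro v hv
      rcases List.mem_cons.1 hv with rfl | hv
      · exact hLH _ h4
      · exact fun hvL => (h6 v hv).2 (by simp [hvL])
    have hcL := hLH _ h4
    have hcp : c ≠ p := by rintro rfl; exact hwH h4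
    have hcz : c ≠ z := by rintro rfl; exact hzH h4
    have hcT1 : c ∉ T1 := fun h => a1 c h (by simp [h4])
    have hcT2 : c ∉ T2 := fun h => a2 c h (by simp [h4])
    have hpM : p ∉ M := fun h => h3 p (by simp [h]) (by simp)
    obtain ⟨nd1, nd2, nd3⟩ := nd_split nd
    have nd4 : (p :: z :: T1).Nodup := List.nodup_cons.2 ⟨fun h => nd3 p h (by simp), nd1⟩
    have hM1 : ∀ v ∈ c :: M, v ∉ p :: T2 ∧ v ∉ z :: T1 ∧ v ∉ p :: z :: T1 := by
      intro v hv
      have hvz : v ∉ z :: T1 := by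
        rcases List.mem_cons.1 hv with rfl | hv
        · simp [hcz, hcT1]
        · exact fun h => (h6 v hv).2 (Or.inl h)
      have hvp : v ≠ p := by
        rcases List.mem_cons.1 hv with rfl | hv
        · exact hcp
        · rintro rfl; exact hpM hv
      have hvT : v ∉ T2 := by
        rcases List.mem_cons.1 hv with rfl | hv
        · exact hcT2
        · exact fun h => (h6 v hv).2 (Or.inr (Or.inl h))
      refine ⟨?_, hvz, ?_⟩
      · simp [hvp, hvT]
      · rw [List.mem_cons, not_or]; exact ⟨hvp, hvz⟩
    have hyM : y ∉ c :: M := by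
      have : c :: (M ++ [y]) = (c :: M) ++ [y] := by simp
      rw [this] at h2
      exact fun h => (nd_split h2).2.2 y h (by simp)
    have hnew : ∀ B, (y :: B).IsChain G.Adj → (c :: (M ++ y :: B)).IsChain G.Adj := fun B hB =>
      chain_join G (A := c :: M) (by simpa using h1) hB
    by_cases hy1 : y ∈ z :: T1
    · obtain ⟨A, B, hAB⟩ := List.append_of_mem hy1
      have hsub : ∀ v ∈ y :: B, v ∈ z :: T1 := by rw [hAB]; intro v hv; exact List.mem_append_right _ hv
      refine ⟨T2, M ++ y :: B, c, c2, ?_, ?_, h4, ?_, ?_, ?_⟩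
      · rw [hAB] at c1; exact hnew B c1.right_of_append
      · refine nd_join nd2 h2 ?_ ?_ ?_
        · rw [hAB] at nd1; exact nd1.of_append_right
        · intro v hv; exact ⟨(hM1 v hv).1, fun h => (hM1 v hv).2.1 (hsub v h)⟩
        · intro v hv; exact nd3 v (hsub v hv)
      · intro v hv hvH; exact a2 v hv (by simp [hvH])
      · intro v hv hvH
        rcases List.mem_append.1 hv with hv | hv
        · exact (h6 v hv).1 hvH
        · rcases List.mem_cons.1 (hsub v hv) with rfl | hv
          · exact hzH hvH
          · exact a1 v hv (by simp [hvH])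
      · rw [hAB] at E
        rcases E with ⟨E1, E2⟩ | ⟨E1, E2⟩
        · exact Or.inr ⟨E2, E1.suffix.prefix hcM⟩
        · exact Or.inl ⟨E2, E1.suffix.prefix hcM⟩
    by_cases hy2 : y ∈ T2
    · obtain ⟨A, B, rfl⟩ := List.append_of_mem hy2
      refine ⟨z :: T1, M ++ y :: B, c, c1w, ?_, ?_, h4, ?_, ?_, ?_⟩
      · exact hnew B (List.IsChain.right_of_append (l₁ := p :: A) (by simpa using c2))
      · have hsub : ∀ v ∈ y :: B, v ∈ p :: (A ++ y :: B) := by intro v hv; exact List.mem_cons_of_mem _ (List.mem_append_right _ hv)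
        have nd5 : (p :: A ++ y :: B).Nodup := by simpa using nd2
        refine nd_join nd4 h2 (nd_split nd5).2.1 ?_ ?_
        · intro v hv; exact ⟨(hM1 v hv).2.2, fun h => (hM1 v hv).1 (hsub v h)⟩
        · intro v hv hv'
          rcases List.mem_cons.1 hv' with rfl | hv'
          · exact (nd_split nd5).2.2 v (by simp) hv
          · exact nd3 v hv' (hsub v hv)
      · intro v hv hvH
        rcases List.mem_cons.1 hv with rfl | hv
        · exact hzH hvH
        · exact a1 v hv (by simp [hvH])
      · intro v hv hvH
        rcases List.mem_append.1 hv with hv | hv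
        · exact (h6 v hv).1 hvH
        · exact a2 v (List.mem_append_right _ hv) (by simp [hvH])
      · rcases E with ⟨E1, E2⟩ | ⟨E1, E2⟩
        · exact Or.inl ⟨Ew _ E1, (Arr.suffix (A := p :: A) E2).prefix hcM⟩
        · exact Or.inr ⟨Ew _ E1, (Arr.suffix (A := p :: A) E2).prefix hcM⟩
    have hyL : y ∈ L := (h5.resolve_left hy1).resolve_left hy2
    have hyp : y ≠ p := by rintro rfl; exact hwL hyL
    have hTn : ∀ v ∈ M ++ [y], v ∉ H := by
      intro v hv hvH
      rcases List.mem_append.1 hv with hv | hv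
      · exact (h6 v hv).1 hvH
      · simp at hv; subst hv; exact hLH _ hvH hyL
    have hAL : Arr L L (c :: (M ++ [y])) := ⟨c :: M, y, by simp, hyL, hcM⟩
    rcases E with ⟨E1, E2⟩ | ⟨E1, E2⟩
    · refine ⟨z :: T1, M ++ [y], c, c1w, h1, ?_, h4, ?_, hTn, Or.inl ⟨Ew _ E1, hAL⟩⟩
      · refine nd_join nd4 h2 (List.nodup_singleton y) ?_ ?_
        · intro v hv; exact ⟨(hM1 v hv).2.2, by simp; rintro rfl; exact hyM hv⟩
        · simp only [List.mem_singleton, forall_eq]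
          rw [List.mem_cons, not_or]; exact ⟨hyp, hy1⟩
      · intro v hv hvH
        rcases List.mem_cons.1 hv with rfl | hv
        · exact hzH hvH
        · exact a1 v hv (by simp [hvH])
    · refine ⟨T2, M ++ [y], c, c2, h1, ?_, h4, ?_, hTn, Or.inl ⟨E2, hAL⟩⟩
      · refine nd_join nd2 h2 (List.nodup_singleton y) ?_ ?_
        · intro v hv; exact ⟨(hM1 v hv).1, by simp; rintro rfl; exact hyM hv⟩
        · simp only [List.mem_singleton, forall_eq]
          rw [List.mem_cons, not_or]; exact ⟨hyp, hy2⟩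
      · intro v hv hvH; exact a2 v hv (by simp [hvH])
  · have hpH : p ∈ H := by simpa [hpw] using hp
    refine ⟨z :: T1, T2, p, c1w, c2, ?_, hpH, ?_, ?_, ?_⟩
    · have hw1 : w ∉ z :: T1 := by
        simp only [List.mem_cons, not_or]
        exact ⟨hzw.ne', fun h => a1 w h (by simp)⟩
      have hw2 : w ∉ p :: T2 := by
        simp only [List.mem_cons, not_or]
        exact ⟨fun h => hpw h.symm, fun h => a2 w h (by simp)⟩
      rw [List.cons_append, List.nodup_cons, List.mem_append]
      exact ⟨not_or.2 ⟨hw1, hw2⟩, nd⟩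
    · intro v hv hvH
      rcases List.mem_cons.1 hv with rfl | hv
      · exact hzH hvH
      · exact a1 v hv (by simp [hvH])
    · intro v hv hvH; exact a2 v hv (by simp [hvH])
    · rcases E with ⟨E1, E2⟩ | ⟨E1, E2⟩
      · exact Or.inl ⟨Ew _ E1, E2⟩
      · exact Or.inr ⟨Ew _ E1, E2⟩

theorem cluster (G : SimpleGraph V) (D : List V) (s x a : V) (hc : (D ++ [s]).IsChain G.Adj)
    (nd : (D ++ [s]).Nodup) (hx : D.head? = some x) (hs : G.Adj x s) (ha : a ∈ D) :
    ∃ γ, (a :: (γ ++ [s])).IsChain G.Adj ∧ (a :: γ).Nodup ∧ (∀ v ∈ γ, v ∈ D) ∧ x ∈ a :: γ ∧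
      ∀ v ∈ D, G.Adj x v → v ∈ a :: γ := by
  obtain ⟨A, B, rfl⟩ := List.append_of_mem ha
  obtain ⟨B1, j, B2, hB, hj, hB1⟩ := exists_first (fun v => G.Adj x v) (B ++ [s]) ⟨s, by simp, hs⟩
  have hjs : ∃ C, j :: B2 = C ++ [s] ∧ B = B1 ++ C := by
    rcases List.eq_nil_or_concat B2 with h0 | ⟨C, d, hd⟩
    · subst h0
      have := List.append_inj' hB rfl
      simp at this
      exact ⟨[], by simp [this]⟩
    · rw [List.concat_eq_append] at hd
      subst hd
      have : B ++ [s] = (B1 ++ j :: C) ++ [d] := by simpa using hB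
      have := List.append_inj' this rfl
      simp at this
      exact ⟨j :: C, by simp [this]⟩
  obtain ⟨C, hC, rfl⟩ := hjs
  have hlast : (a :: A.reverse).getLast? = some x := by
    have : a :: A.reverse = (A ++ [a]).reverse := by simp
    rw [this, List.getLast?_reverse]
    cases A <;> simpa using hx
  have e1 : A ++ a :: (B1 ++ C) ++ [s] = (A ++ [a]) ++ (B1 ++ (j :: B2)) := by rw [hC]; simp
  have e2 : a :: (A.reverse ++ C ++ [s]) = (A ++ [a]).reverse ++ (j :: B2) := by rw [hC]; simp
  have hxm : x ∈ a :: A.reverse := List.mem_of_getLast? hlast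
  refine ⟨A.reverse ++ C, ?_, ?_, ?_, ?_, ?_⟩
  · rw [e2]
    rw [e1] at hc
    refine List.isChain_append.2 ⟨chain_rev G hc.left_of_append,
      hc.right_of_append.right_of_append, ?_⟩
    intro y hy w hw
    have e3 : (A ++ [a]).reverse = a :: A.reverse := by simp
    rw [e3, hlast] at hy
    simp at hy hw
    subst hy; subst hw
    exact hj
  · have h1 := nd.of_append_left
    have : (a :: (A.reverse ++ C)).Perm (A ++ a :: C) := by
      have : a :: (A.reverse ++ C) = (A ++ [a]).reverse ++ C := by simp
      rw [this]
      have h2 : A ++ a :: C = (A ++ [a]) ++ C := by simp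
      rw [h2]
      exact (List.reverse_perm _).append_right _
    rw [this.nodup_iff]
    refine h1.sublist ?_
    exact List.Sublist.append_left (List.Sublist.cons_cons a (List.sublist_append_right B1 C)) A
  · intro v hv
    simp at hv ⊢
    rcases hv with hv | hv <;> simp [hv]
  · simp at hxm ⊢
    rcases hxm with hv | hv <;> simp [hv]
  · intro v hv hxv
    have : v ∉ B1 := fun h => hB1 v h hxv
    simp [this] at hv ⊢
    tauto

theorem chain_overlap (G : SimpleGraph V) {A X B : List V} (hX : X ≠ [])
    (h1 : (A ++ X).IsChain G.Adj) (h2 : (X ++ B).IsChain G.Adj) : (A ++ X ++ B).IsChain G.Adj := by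
  rw [List.isChain_append] at h2 ⊢
  refine ⟨h1, h2.2.1, ?_⟩
  intro x hx y hy
  refine h2.2.2 x ?_ y hy
  rwa [List.getLast?_append_of_ne_nil _ hX] at hx

theorem link (G : SimpleGraph V) {A γ B : List V} {a b : V} (h1 : (A ++ [a]).IsChain G.Adj)
    (h2 : (a :: (γ ++ [b])).IsChain G.Adj) (h3 : (b :: B).IsChain G.Adj) :
    ((A ++ [a]) ++ γ ++ b :: B).IsChain G.Adj := by
  have := chain_join G (A := A) h1 (chain_join G (A := a :: γ) (by simpa using h2) h3)
  simpa using this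

/-- `l` lists the vertices of a cycle. -/
def Cyc (G : SimpleGraph V) (l : List V) : Prop := l.Nodup ∧ (l ++ l).IsChain G.Adj

theorem Cyc.rotate {G : SimpleGraph V} {l : List V} (h : Cyc G l) {c : V} (hc : c ∈ l) :
    ∃ B, (c :: B).IsChain G.Adj ∧ (c :: B).Perm l := by
  obtain ⟨A, B, rfl⟩ := List.append_of_mem hc
  refine ⟨B ++ A, ?_, ?_⟩
  · have h2 := h.2
    have e : A ++ c :: B ++ (A ++ c :: B) = A ++ ((c :: (B ++ A)) ++ (c :: B)) := by simp
    rw [e] at h2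
    exact h2.right_of_append.left_of_append
  · have : c :: (B ++ A) = (c :: B) ++ A := by simp
    rw [this]
    exact List.perm_append_comm

theorem close_cycle (G : SimpleGraph V) {T1 T2 A1 A2 γ1 γ2 : List V} {z p b1 b2 : V}
    (hZ : z :: T1 = A1 ++ [b1]) (hQ : p :: T2 = A2 ++ [b2]) (c1 : (z :: T1).IsChain G.Adj)
    (c2 : (p :: T2).IsChain G.Adj) (c3 : (z :: (γ1 ++ [p])).IsChain G.Adj)
    (c4 : (b2 :: (γ2 ++ [b1])).IsChain G.Adj)
    (nd : ((z :: T1).reverse ++ γ1 ++ p :: T2 ++ γ2).Nodup) :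
    Cyc G ((z :: T1).reverse ++ γ1 ++ p :: T2 ++ γ2) := by
  refine ⟨nd, ?_⟩
  have k1 : ((z :: T1).reverse ++ γ1 ++ p :: T2).IsChain G.Adj := by
    have := link G (A := T1.reverse) (a := z) (by simpa using chain_rev G c1) c3 c2
    simpa using this
  have k2 : (p :: T2 ++ γ2 ++ (z :: T1).reverse).IsChain G.Adj := by
    have hZ' : (z :: T1).reverse = b1 :: A1.reverse := by rw [hZ]; simp
    have h5 := chain_rev G c1
    rw [hZ'] at h5 ⊢
    rw [hQ] at c2 ⊢
    exact link G c2 c4 h5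
  have k3 := chain_overlap G (A := (z :: T1).reverse ++ γ1) (X := p :: T2)
    (B := γ2 ++ (z :: T1).reverse) (by simp) k1 (by simpa using k2)
  have k4 := chain_overlap G (A := (z :: T1).reverse ++ γ1 ++ p :: T2 ++ γ2)
    (X := (z :: T1).reverse) (B := γ1 ++ p :: T2 ++ γ2) (by simp) (by simpa using k3) (by
      have := k3.left_of_append
      have e : (z :: T1).reverse ++ γ1 ++ p :: T2 ++ (γ2 ++ (z :: T1).reverse) =
        ((z :: T1).reverse ++ (γ1 ++ p :: T2 ++ γ2)) ++ (z :: T1).reverse := by simp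
      rw [e] at k3
      exact k3.left_of_append)
  simpa using k4

theorem vine_cycle (G : SimpleGraph V) (D H : List V) (s z x x' : V)
    (hSt : St G {v | v ∈ D} s z H)
    (hc : (D ++ [s]).IsChain G.Adj) (nd : (D ++ [s]).Nodup) (hx : D.head? = some x)
    (hs : G.Adj x s) (hc' : (z :: H).IsChain G.Adj) (nd' : (z :: H).Nodup)
    (hx' : H.getLast? = some x') (hz : G.Adj x' z)
    (hDH : ∀ v ∈ H, v ∉ D) :
    ∃ l, Cyc G l ∧ x ∈ l ∧ x' ∈ l ∧ (∀ v ∈ D ++ [s], G.Adj x v → v ∈ l) ∧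
      (∀ v ∈ z :: H, G.Adj x' v → v ∈ l) := by
  obtain ⟨T1, T2, p, c1, c2, ndT, hp, a1, a2, E⟩ := hSt
  have hsD : s ∉ D := fun h => (nd_split nd).2.2 s h (by simp)
  have hzH : z ∉ H := (List.nodup_cons.1 nd').1
  obtain ⟨γ', g1, g2, g3, g4, g5⟩ := cluster G H.reverse z x' p
    (by simpa using chain_rev G hc') (by simpa using (List.nodup_reverse.2 nd'))
    (by simpa using hx') hz (by simpa using hp)
  have g1r : (z :: (γ'.reverse ++ [p])).IsChain G.Adj := by simpa using chain_rev G g1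
  simp only [List.mem_reverse] at g3 g5
  have key : ∃ A1 b1 A2 b2 γ2 a, z :: T1 = A1 ++ [b1] ∧ p :: T2 = A2 ++ [b2] ∧
      (b2 :: (γ2 ++ [b1])).IsChain G.Adj ∧ γ2.Nodup ∧ (∀ v ∈ γ2, v ∈ D) ∧
      (∀ v ∈ γ2, v ∉ z :: T1 ∧ v ∉ p :: T2) ∧
      (∀ v, v ∈ a :: γ2 → v ∈ z :: T1 ∨ v ∈ p :: T2 ∨ v ∈ γ2) ∧
      (s ∈ z :: T1 ∨ s ∈ p :: T2) ∧ x ∈ a :: γ2 ∧ ∀ v ∈ D, G.Adj x v → v ∈ a :: γ2 := by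
    rcases E with ⟨⟨A1, b1, e1, m1, n1⟩, ⟨A2, b2, e2, m2, n2⟩⟩ |
      ⟨⟨A1, b1, e1, m1, n1⟩, ⟨A2, b2, e2, m2, n2⟩⟩
    · simp only [Set.mem_singleton_iff] at m1
      subst m1
      obtain ⟨γ, k1, k2, k3, k4, k5⟩ := cluster G D b1 x b2 hc nd hx hs m2
      refine ⟨A1, b1, A2, b2, γ, b2, e1, e2, k1, (List.nodup_cons.1 k2).2, k3, ?_, ?_, ?_, k4, k5⟩
      · intro v hv
        rw [e1, e2]
        have h1 := k3 v hv
        simp only [List.mem_append, List.mem_singleton, not_or]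
        refine ⟨⟨fun h => n1 v h h1, ?_⟩, fun h => n2 v h h1, ?_⟩
        · rintro rfl; exact hsD h1
        · rintro rfl; exact (List.nodup_cons.1 k2).1 hv
      · intro v hv
        rcases List.mem_cons.1 hv with rfl | hv
        · right; left; rw [e2]; simp
        · exact Or.inr (Or.inr hv)
      · left; rw [e1]; simp
    · simp only [Set.mem_singleton_iff] at m2
      subst m2
      obtain ⟨γ, k1, k2, k3, k4, k5⟩ := cluster G D b2 x b1 hc nd hx hs m1
      refine ⟨A1, b1, A2, b2, γ.reverse, b1, e1, e2, by simpa using chain_rev G k1,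
        List.nodup_reverse.2 (List.nodup_cons.1 k2).2, by simpa using k3, ?_, ?_, ?_, by simpa using k4,
        by simpa using k5⟩
      · intro v hv
        rw [List.mem_reverse] at hv
        rw [e1, e2]
        have h1 := k3 v hv
        simp only [List.mem_append, List.mem_singleton, not_or]
        refine ⟨⟨fun h => n1 v h h1, ?_⟩, fun h => n2 v h h1, ?_⟩
        · rintro rfl; exact (List.nodup_cons.1 k2).1 hv
        · rintro rfl; exact hsD h1
      · intro v hv
        rcases List.mem_cons.1 hv with rfl | hv
        · left; rw [e1]; simp
        · exact Or.inr (Or.inr hv)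
      · right; rw [e2]; simp
  obtain ⟨A1, b1, A2, b2, γ2, a, e1, e2, q1, q2, q3, q4, q5, q6, q7, q8⟩ := key
  obtain ⟨n1, n2, n3⟩ := nd_split ndT
  refine ⟨_, close_cycle G e1 e2 c1 c2 g1r q1 ?_, ?_, ?_, ?_, ?_⟩
  · refine List.Nodup.append (List.Nodup.append (List.Nodup.append (List.nodup_reverse.2 n1)
      (List.nodup_reverse.2 (List.nodup_cons.1 g2).2) ?_) n2 ?_) q2 ?_
    · intro v hv hv'
      rw [List.mem_reverse] at hv hv'
      rcases List.mem_cons.1 hv with rfl | hv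
      · exact hzH (g3 _ hv')
      · exact a1 v hv (g3 _ hv')
    · intro v hv hv'
      rcases List.mem_append.1 hv with hv | hv <;> rw [List.mem_reverse] at hv
      · exact n3 v hv hv'
      · rcases List.mem_cons.1 hv' with rfl | hv'
        · exact (List.nodup_cons.1 g2).1 hv
        · exact a2 v hv' (g3 _ hv)
    · intro v hv hv'
      rcases List.mem_append.1 hv with hv | hv
      · rcases List.mem_append.1 hv with hv | hv <;> rw [List.mem_reverse] at hv
        · exact (q4 v hv').1 hv
        · exact hDH v (g3 _ hv) (q3 v hv')
      · exact (q4 v hv').2 hv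
  · have := q5 x q7
    simp only [List.mem_append, List.mem_reverse]
    rcases this with h | h | h <;> simp only [h, true_or, or_true]
  · have : x' ∈ p :: T2 ∨ x' ∈ γ' := by
      rcases List.mem_cons.1 g4 with rfl | h
      · left; simp
      · exact Or.inr h
    simp only [List.mem_append, List.mem_reverse]
    rcases this with h | h <;> simp only [h, true_or, or_true]
  · intro v hv hxv
    have : v ∈ z :: T1 ∨ v ∈ p :: T2 ∨ v ∈ γ2 := by
      rcases List.mem_append.1 hv with hv | hv
      · exact q5 v (q8 v hv hxv)
      · simp at hv; subst hv; exact q6.imp_right Or.inl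
    simp only [List.mem_append, List.mem_reverse]
    rcases this with h | h | h <;> simp only [h, true_or, or_true]
  · intro v hv hxv
    have : v ∈ z :: T1 ∨ v ∈ p :: T2 ∨ v ∈ γ' := by
      rcases List.mem_cons.1 hv with rfl | hv
      · simp
      · rcases List.mem_cons.1 (g5 v hv hxv) with rfl | h
        · simp
        · exact Or.inr (Or.inr h)
    simp only [List.mem_append, List.mem_reverse]
    rcases this with h | h | h <;> simp only [h, true_or, or_true]

theorem nbr_mem (G : SimpleGraph V) {P : List V} {x v : V} (hc : P.IsChain G.Adj) (nd : P.Nodup)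
    (hmax : ∀ l : List V, l.IsChain G.Adj → l.Nodup → l.length ≤ P.length)
    (hx : P.head? = some x) (hxv : G.Adj x v) : v ∈ P := by
  by_contra hv
  have h1 : (v :: P).IsChain G.Adj := by
    rw [List.isChain_cons]
    refine ⟨?_, hc⟩
    intro y hy
    rw [hx] at hy
    simp at hy
    subst hy
    exact hxv.symm
  have := hmax (v :: P) h1 (List.nodup_cons.2 ⟨hv, nd⟩)
  simp at this

theorem dirac [Fintype V] [DecidableEq V] (G : SimpleGraph V)
    [DecidableRel G.Adj] (h : ℕ) (hh : 2 ≤ h) (hG : TwoConnected G) (P : List V) (x x' : V)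
    (hc : P.IsChain G.Adj) (nd : P.Nodup)
    (hmax : ∀ l : List V, l.IsChain G.Adj → l.Nodup → l.length ≤ P.length)
    (hx : P.head? = some x) (hx' : P.getLast? = some x')
    (hd : h ≤ G.degree x) (hd' : h ≤ G.degree x') :
    ∃ l, Cyc G l ∧ min (Fintype.card V) (2 * h) ≤ l.length := by
  classical
  obtain ⟨f, hf⟩ : ∃ f : ℕ → V, ∀ k (hk : k < P.length), P[k] = f k :=
    ⟨fun k => P.getD k x, fun k hk => by simp [hk]⟩
  obtain ⟨m, hm⟩ : ∃ m, P.length = m := ⟨_, rfl⟩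
  have hP : P ≠ [] := by rintro rfl; simp at hx
  have hm0 : 0 < m := by rw [← hm]; exact List.length_pos_iff.2 hP
  have hf0 : f 0 = x := by
    rw [← hf 0 (by omega)]
    rw [List.head?_eq_getElem?, List.getElem?_eq_getElem (by omega)] at hx
    simpa using hx
  have hfm : f (m - 1) = x' := by
    rw [← hf (m - 1) (by omega)]
    rw [List.getLast?_eq_getElem?, List.getElem?_eq_getElem (by omega)] at hx'
    simp only [hm] at hx'
    simpa using hx'
  have hinj : ∀ i j, i < m → j < m → f i = f j → i = j := by
    intro i j hi hj hij
    rw [← hf i (by omega), ← hf j (by omega)] at hij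
    exact (nd.getElem_inj_iff).1 hij
  have hN : ∀ v, G.Adj x v → ∃ k < m, f k = v := by
    intro v hv
    obtain ⟨k, hk, hkv⟩ := List.getElem_of_mem (nbr_mem G hc nd hmax hx hv)
    exact ⟨k, by omega, by rw [← hkv, hf]⟩
  have hN' : ∀ v, G.Adj x' v → ∃ k < m, f k = v := by
    intro v hv
    have hv := nbr_mem G (P := P.reverse) (chain_rev G hc) (List.nodup_reverse.2 nd)
      (by simpa using hmax) (by simpa using hx') hv
    rw [List.mem_reverse] at hv
    obtain ⟨k, hk, hkv⟩ := List.getElem_of_mem hv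
    exact ⟨k, by omega, by rw [← hkv, hf]⟩
  have hnb : ∃ k, k < m ∧ G.Adj x (f k) := by
    obtain ⟨v, hv⟩ := (G.degree_pos_iff_exists_adj x).1 (by omega)
    obtain ⟨k, hk, rfl⟩ := hN v hv
    exact ⟨k, hk, hv⟩
  have hnb' : ∃ k, k < m ∧ G.Adj x' (f k) := by
    obtain ⟨v, hv⟩ := (G.degree_pos_iff_exists_adj x').1 (by omega)
    obtain ⟨k, hk, rfl⟩ := hN' v hv
    exact ⟨k, hk, hv⟩
  by_cases hcross : ∃ g i, i + g + 1 < m ∧ G.Adj x (f (i + g + 1)) ∧ G.Adj x' (f i)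
  · -- crossing case
    obtain ⟨g, ⟨i, hi, hxi, hxi'⟩, hmin⟩ :
        ∃ g, (∃ i, i + g + 1 < m ∧ G.Adj x (f (i + g + 1)) ∧ G.Adj x' (f i)) ∧
          ∀ g' < g, ¬ ∃ i, i + g' + 1 < m ∧ G.Adj x (f (i + g' + 1)) ∧ G.Adj x' (f i) :=
      ⟨Nat.find hcross, Nat.find_spec hcross, fun g' hg' => Nat.find_min hcross hg'⟩
    have hcyc : Cyc G (P.take (i + 1) ++ (P.drop (i + g + 1)).reverse) := by
      have cX : (P.take (i + 1)).IsChain G.Adj := hc.take _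
      have cY : (P.drop (i + g + 1)).reverse.IsChain G.Adj := chain_rev G (hc.drop _)
      have hX0 : (P.take (i + 1)).head? = some x := by rw [List.head?_take, if_neg (by omega), hx]
      have hXl : (P.take (i + 1)).getLast? = some (f i) := by
        rw [List.getLast?_eq_getElem?]
        have : (P.take (i + 1)).length - 1 = i := by simp; omega
        rw [this, List.getElem?_take_of_lt (by omega), List.getElem?_eq_getElem (by omega),
          hf i (by omega)]
      have hY0 : (P.drop (i + g + 1)).reverse.head? = some x' := by
        rw [List.head?_reverse, List.getLast?_drop, if_neg (by omega), hx']
      have hYl : (P.drop (i + g + 1)).reverse.getLast? = some (f (i + g + 1)) := by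
        rw [List.getLast?_reverse, List.head?_drop, List.getElem?_eq_getElem (by omega),
          hf _ (by omega)]
      have k1 : (P.take (i + 1) ++ (P.drop (i + g + 1)).reverse).IsChain G.Adj := by
        refine List.isChain_append.2 ⟨cX, cY, ?_⟩
        rw [hXl, hY0]
        simp
        exact hxi'.symm
      have k2 : ((P.drop (i + g + 1)).reverse ++ P.take (i + 1)).IsChain G.Adj := by
        refine List.isChain_append.2 ⟨cY, cX, ?_⟩
        rw [hYl, hX0]
        simp
        exact hxi.symm
      refine ⟨?_, ?_⟩
      · have : (P.take (i + 1) ++ (P.drop (i + g + 1)).reverse).Perm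
            (P.take (i + 1) ++ P.drop (i + g + 1)) := (List.reverse_perm _).append_left _
        rw [this.nodup_iff]
        refine nd.sublist ?_
        conv_rhs => rw [← List.take_append_drop (i + 1) P]
        refine List.Sublist.append_left ?_ _
        exact List.drop_sublist_drop_left P (by omega)
      · have k3 := chain_overlap G (by intro h0; rw [h0] at hY0; simp at hY0) k1 k2
        have k4 := chain_overlap G (by intro h0; rw [h0] at hX0; simp at hX0) k3 k1
        simpa using k4
    have hlen : (P.take (i + 1) ++ (P.drop (i + g + 1)).reverse).length = i + 1 + (m - (i + g + 1)) := by
      simp; omega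
    generalize P.take (i + 1) ++ (P.drop (i + g + 1)).reverse = l at hcyc hlen
    refine ⟨l, hcyc, ?_⟩
    rw [hlen]
    rcases Nat.eq_zero_or_pos g with rfl | hg
    · -- Hamiltonian
      refine (min_le_left _ _).trans ?_
      by_contra hlt
      have hlm : l.length = m := by omega
      have : ∃ v, v ∉ l := by
        by_contra hall
        push Not at hall
        have h1 : (Finset.univ : Finset V) ⊆ l.toFinset := fun v _ => by simpa using hall v
        have h2 := Finset.card_le_card h1
        have h3 := l.toFinset_card_le
        rw [Finset.card_univ] at h2
        omega
      obtain ⟨v, hv⟩ := this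
      obtain ⟨y0, hy0⟩ : ∃ y, y ∈ l := List.exists_mem_of_length_pos (by omega)
      obtain ⟨c, M, y, b1, b2, b3, b4, b5, b6⟩ := bridge G ∅ (hG.2 ∅ (by simp)) {v | v ∉ l} {v | v ∈ l}
        v y0 (by simp) (by simp) hv hy0 (fun v hv => hv)
      have hM : M = [] := by
        cases M with
        | nil => rfl
        | cons d M => have := b6 d (by simp); simp only [Set.mem_ofPred_eq] at this; tauto
      subst hM
      obtain ⟨B, hB1, hB2⟩ := hcyc.rotate b5
      have e1 : (c :: y :: B).IsChain G.Adj := by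
        simp at b1
        exact List.isChain_cons_cons.2 ⟨b1, hB1⟩
      have e2 : (c :: y :: B).Nodup := by
        refine List.nodup_cons.2 ⟨?_, hB2.nodup_iff.2 hcyc.1⟩
        rw [hB2.mem_iff]; exact b4
      have := hmax _ e1 e2
      have := hB2.length_eq
      simp at *
      omega
    · refine (min_le_right _ _).trans ?_
      let I := (Finset.range (m - 1)).filter (fun k => G.Adj x' (f k))
      let J := (Finset.range (m - 1)).filter (fun k => G.Adj x (f (k + 1)))
      have hI : h ≤ I.card := by
        refine hd'.trans ?_
        rw [← G.card_neighborFinset_eq_degree]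
        have : G.neighborFinset x' ⊆ I.image f := by
          intro v hv
          rw [mem_neighborFinset] at hv
          obtain ⟨k, hk, rfl⟩ := hN' v hv
          refine Finset.mem_image.2 ⟨k, ?_, rfl⟩
          have : k ≠ m - 1 := by rintro rfl; rw [hfm] at hv; exact hv.ne rfl
          simp [I, hv]; omega
        exact (Finset.card_le_card this).trans Finset.card_image_le
      have hJ : h ≤ J.card := by
        refine hd.trans ?_
        rw [← G.card_neighborFinset_eq_degree]
        have : G.neighborFinset x ⊆ J.image (fun k => f (k + 1)) := by
          intro v hv
          rw [mem_neighborFinset] at hv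
          obtain ⟨k, hk, rfl⟩ := hN v hv
          have h0 : k ≠ 0 := by rintro rfl; rw [hf0] at hv; exact hv.ne rfl
          obtain ⟨k, rfl⟩ := Nat.exists_eq_succ_of_ne_zero h0
          refine Finset.mem_image.2 ⟨k, ?_, rfl⟩
          simp [J]
          exact ⟨by omega, hv⟩
        exact (Finset.card_le_card this).trans Finset.card_image_le
      have hdis : Disjoint I J := by
        rw [Finset.disjoint_left]
        intro k hk hk'
        simp [I, J] at hk hk'
        exact hmin 0 hg ⟨k, by omega, hk'.2, hk.2⟩
      have hsub : I ∪ J ⊆ Finset.range (i + 1) ∪ Finset.Ico (i + g) (m - 1) := by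
        intro k hk
        simp [I, J] at hk
        simp
        by_contra hcon
        rcases hk with ⟨hk, hka⟩ | ⟨hk, hka⟩
        · refine hmin (i + g - k) (by omega) ⟨k, by omega, ?_, hka⟩
          have : k + (i + g - k) + 1 = i + g + 1 := by omega
          rwa [this]
        · refine hmin (k - i) (by omega) ⟨i, by omega, ?_, hxi'⟩
          have : i + (k - i) + 1 = k + 1 := by omega
          rwa [this]
      have h1 := Finset.card_le_card hsub
      rw [Finset.card_union_of_disjoint hdis] at h1
      have h2 := Finset.card_union_le (Finset.range (i + 1)) (Finset.Ico (i + g) (m - 1))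
      rw [Finset.card_range, Nat.card_Ico] at h2
      omega
  · -- no crossing
    have hnc : ∀ i j, i < m → j < m → G.Adj x (f j) → G.Adj x' (f i) → j ≤ i := by
      intro i j hi hj h1 h2
      by_contra hlt
      exact hcross ⟨j - i - 1, i, by omega, by
        have : i + (j - i - 1) + 1 = j := by omega
        rwa [this], h2⟩
    obtain ⟨t, ⟨htm, hta⟩, htmin⟩ : ∃ t, (t < m ∧ G.Adj x' (f t)) ∧
        ∀ k, k < m → G.Adj x' (f k) → t ≤ k :=
      ⟨Nat.find hnb', Nat.find_spec hnb', fun k hk hk' => Nat.find_min' hnb' ⟨hk, hk'⟩⟩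
    obtain ⟨s, ⟨hsm, hsa⟩, hsmax⟩ : ∃ s, (s < m ∧ G.Adj x (f s)) ∧
        ∀ k, k < m → G.Adj x (f k) → k ≤ s := by
      obtain ⟨k, hk⟩ := hnb
      refine ⟨Nat.findGreatest (fun k => k < m ∧ G.Adj x (f k)) m,
        Nat.findGreatest_spec (P := fun k => k < m ∧ G.Adj x (f k)) hk.1.le hk, ?_⟩
      intro k hk hk'
      exact Nat.le_findGreatest hk.le ⟨hk, hk'⟩
    have hst : s ≤ t := hnc t s htm hsm hsa hta
    have hs0 : 0 < s := by
      rcases Nat.eq_zero_or_pos s with rfl | h0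
      · rw [hf0] at hsa; exact absurd rfl hsa.ne
      · exact h0
    have htm1 : t + 1 < m := by
      have : t ≠ m - 1 := by rintro rfl; rw [hfm] at hta; exact hta.ne rfl
      omega
    have memD : ∀ v, v ∈ P.take s ↔ ∃ k < s, f k = v := by
      intro v
      rw [List.mem_take_iff_getElem]
      constructor
      · rintro ⟨k, hk, rfl⟩
        exact ⟨k, by omega, (hf _ _).symm⟩
      · rintro ⟨k, hk, rfl⟩
        exact ⟨k, by omega, hf _ _⟩
    have memH : ∀ j v, v ∈ P.drop j ↔ ∃ k, j ≤ k ∧ k < m ∧ f k = v := by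
      intro j v
      rw [List.mem_drop_iff_getElem]
      constructor
      · rintro ⟨k, hk, rfl⟩
        exact ⟨j + k, by omega, by omega, (hf _ _).symm⟩
      · rintro ⟨k, hk, hk', rfl⟩
        refine ⟨k - j, by omega, ?_⟩
        rw [hf]; congr 1; omega
    have hdrop : ∀ k, k < m → P.drop k = f k :: P.drop (k + 1) := by
      intro k hk
      rw [List.drop_eq_getElem_cons (by omega), hf]
    have hDH : ∀ k, s ≤ k → ∀ v ∈ P.drop k, v ∉ P.take s := by
      intro k hk v hv hv'
      obtain ⟨j, hj, rfl⟩ := (memD v).1 hv'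
      obtain ⟨j', h1, h2, h3⟩ := (memH k _).1 hv
      have := hinj _ _ h2 (by omega) h3
      omega
    have hxD : x ∈ P.take s := (memD x).2 ⟨0, hs0, hf0⟩
    have hSt : ∀ k, s ≤ k → k + 1 < m → St G {v | v ∈ P.take s} (f s) (f k) (P.drop (k + 1)) := by
      intro k hk
      induction k, hk using Nat.le_induction with
      | base =>
        intro hsm1
        refine St.base G _ _ _ (hG.2 {f s} (by simp)) ⟨x, hxD⟩ ?_ ?_ ?_ ?_
        · rw [hdrop _ hsm1]; simp
        · exact hDH s le_rfl _ (by rw [hdrop s hsm]; simp)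
        · have := nd.sublist (List.drop_sublist s P)
          rw [hdrop s hsm] at this
          exact (List.nodup_cons.1 this).1
        · exact hDH (s + 1) (by omega)
      | succ k hk ih =>
        intro hk2
        have ih := ih (by omega)
        rw [hdrop (k + 1) (by omega)] at ih
        have hck : (f k :: f (k + 1) :: P.drop (k + 1 + 1)).IsChain G.Adj := by
          rw [← hdrop (k + 1) (by omega), ← hdrop k (by omega)]
          exact hc.drop _
        refine St.step G _ _ _ _ _ (hG.2 {f (k + 1)} (by simp)) ⟨x, hxD⟩ ?_ ?_ ?_ ?_ ?_ ?_ ih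
        · rw [hdrop _ hk2]; simp
        · exact (List.isChain_cons_cons.1 hck).1
        · exact hDH (k + 1) (by omega) _ (by rw [hdrop _ (by omega)]; simp)
        · exact hDH k (by omega) _ (by rw [hdrop _ (by omega)]; simp)
        · rw [← hdrop (k + 1) (by omega), ← hdrop k (by omega)]
          exact nd.sublist (List.drop_sublist k P)
        · exact hDH (k + 1 + 1) (by omega)
    have hDs : P.take s ++ [f s] = P.take (s + 1) := by
      rw [List.take_add_one, List.getElem?_eq_getElem (by omega), hf s (by omega)]; simp
    obtain ⟨l, hl, l1, l2, l3, l4⟩ := vine_cycle G (P.take s) (P.drop (t + 1)) (f s) (f t) x x'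
      (hSt t hst htm1) (by rw [hDs]; exact hc.take _)
      (by rw [hDs]; exact nd.sublist (List.take_sublist _ _))
      (by rw [List.head?_take, if_neg (by omega), hx]) hsa
      (by rw [← hdrop t htm]; exact hc.drop _)
      (by rw [← hdrop t htm]; exact nd.sublist (List.drop_sublist _ _))
      (by rw [List.getLast?_drop, if_neg (by omega), hx']) hta (hDH _ (by omega))
    refine ⟨l, hl, (min_le_right _ _).trans ?_⟩
    have hsub : insert x (G.neighborFinset x) ∪ G.neighborFinset x' ⊆ l.toFinset := by
      intro v hv
      rw [List.mem_toFinset]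
      rw [Finset.mem_union, Finset.mem_insert, mem_neighborFinset, mem_neighborFinset] at hv
      rcases hv with (rfl | hv) | hv
      · exact l1
      · refine l3 v ?_ hv
        obtain ⟨k, hk, rfl⟩ := hN v hv
        have := hsmax k hk hv
        rcases Nat.lt_or_ge k s with h1 | h1
        · exact List.mem_append_left _ ((memD _).2 ⟨k, h1, rfl⟩)
        · have : k = s := by omega
          subst this; simp
      · refine l4 v ?_ hv
        obtain ⟨k, hk, rfl⟩ := hN' v hv
        rw [← hdrop t htm]
        exact (memH _ _).2 ⟨k, htmin k hk hv, hk, rfl⟩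
    have hint : insert x (G.neighborFinset x) ∩ G.neighborFinset x' ⊆ {f s} := by
      intro v hv
      rw [Finset.mem_inter, Finset.mem_insert, mem_neighborFinset, mem_neighborFinset] at hv
      obtain ⟨hv, hv'⟩ := hv
      obtain ⟨k, hk, rfl⟩ := hN' v hv'
      have h1 := htmin k hk hv'
      rw [Finset.mem_singleton]
      rcases hv with hv | hv
      · rw [← hf0] at hv
        have := hinj _ _ hk hm0 hv
        omega
      · have h2 := hsmax k hk hv
        have : k = s := by omega
        rw [this]
    have h1 := Finset.card_le_card hsub
    have h2 := Finset.card_le_card hint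
    have h3 := Finset.card_union_add_card_inter (insert x (G.neighborFinset x)) (G.neighborFinset x')
    have h4 := l.toFinset_card_le
    rw [Finset.card_insert_of_notMem (by simp), G.card_neighborFinset_eq_degree,
      G.card_neighborFinset_eq_degree] at h3
    rw [Finset.card_singleton] at h2
    omega

theorem exists_longest [Fintype V] [DecidableEq V] (G : SimpleGraph V)
    (hG : TwoConnected G) (u : V) :
    ∃ (P : List V) (x x' : V), P.IsChain G.Adj ∧ P.Nodup ∧
      (∀ l : List V, l.IsChain G.Adj → l.Nodup → l.length ≤ P.length) ∧
      P.head? = some x ∧ P.getLast? = some x' ∧ x ≠ u ∧ x' ≠ u := by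
  classical
  obtain ⟨P, hc, nd, hmax⟩ : ∃ P : List V, P.IsChain G.Adj ∧ P.Nodup ∧
      (∀ l : List V, l.IsChain G.Adj → l.Nodup → l.length ≤ P.length) := by
    let Q : ℕ → Prop := fun k => ∃ P : List V, P.IsChain G.Adj ∧ P.Nodup ∧ P.length = k
    have h0 : Q 0 := ⟨[], by simp⟩
    obtain ⟨P, h1, h2, h3⟩ := Nat.findGreatest_spec (P := Q) (Nat.zero_le (Fintype.card V)) h0
    refine ⟨P, h1, h2, fun l hl hl' => ?_⟩
    rw [h3]
    exact Nat.le_findGreatest hl'.length_le_card ⟨l, hl, hl', rfl⟩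
  -- `u` has two neighbours
  have hnb : ∀ y, y ≠ u → ∃ w, w ≠ y ∧ G.Adj u w := by
    intro y hy
    obtain ⟨b, hb⟩ : ∃ b, b ∉ ({u, y} : Finset V) := by
      by_contra hcon
      push Not at hcon
      have h1 : (Finset.univ : Finset V) ⊆ {u, y} := fun v _ => hcon v
      have h2 := Finset.card_le_card h1
      have h3 := Finset.card_le_two (a := u) (b := y)
      rw [Finset.card_univ] at h2
      have := hG.1
      omega
    simp at hb
    obtain ⟨l, l1, l2, l3, l4, l5⟩ := conn_path G {y} (hG.2 {y} (by simp)) u b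
      (by simpa using hy.symm) (by simpa using hb.2)
    match l, l1, l2, l3, l4, l5 with
    | [], _, _, l3, _, _ => simp at l3
    | [a], _, _, l3, l4, _ => simp at l3 l4; exact absurd (l4.symm.trans l3) hb.1
    | a :: w :: l, l1, _, l3, _, l5 =>
      simp at l3
      subst l3
      exact ⟨w, by simpa using l5 w (by simp), (List.isChain_cons_cons.1 l1).1⟩
  have hlen : 2 ≤ P.length := by
    obtain ⟨y, hy⟩ : ∃ y, y ≠ u := by
      have := hG.1
      have : Nontrivial V := Fintype.one_lt_card_iff_nontrivial.1 (by omega)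
      exact exists_ne u
    obtain ⟨w, _, hw⟩ := hnb y hy
    have := hmax [u, w] (by simpa using hw) (by simpa using hw.ne)
    simpa using this
  -- main claim when the head is `u`
  have main : ∀ P : List V, P.IsChain G.Adj → P.Nodup →
      (∀ l : List V, l.IsChain G.Adj → l.Nodup → l.length ≤ P.length) → 2 ≤ P.length →
      P.head? = some u → ∃ (P : List V) (x x' : V), P.IsChain G.Adj ∧ P.Nodup ∧
      (∀ l : List V, l.IsChain G.Adj → l.Nodup → l.length ≤ P.length) ∧
      P.head? = some x ∧ P.getLast? = some x' ∧ x ≠ u ∧ x' ≠ u := by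
    intro P hc nd hmax hlen hu
    match P, hc, nd, hmax, hlen, hu with
    | [], _, _, _, hlen, _ => simp at hlen
    | [a], _, _, _, hlen, _ => simp at hlen
    | a :: y :: P, hc, nd, hmax, hlen, hu =>
      simp at hu
      subst hu
      have hy : y ≠ a := (List.isChain_cons_cons.1 hc).1.ne'
      obtain ⟨w, hwy, hw⟩ := hnb y hy
      have hwP := nbr_mem G hc nd hmax (by simp) hw
      have hwP : w ∈ P := by
        simp [hwy, hw.ne'] at hwP
        exact hwP
      obtain ⟨A, B, rfl⟩ := List.append_of_mem hwP
      have e : a :: y :: (A ++ w :: B) = (a :: y :: A) ++ w :: B := by simp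
      rw [e] at hc nd hmax
      have hperm : ((a :: y :: A).reverse ++ w :: B).Perm ((a :: y :: A) ++ w :: B) :=
        (List.reverse_perm _).append_right _
      obtain ⟨x, hx⟩ : ∃ x, (y :: A).getLast? = some x := ⟨_, List.getLast?_eq_some_getLast (by simp)⟩
      obtain ⟨x', hx'⟩ : ∃ x, (w :: B).getLast? = some x := ⟨_, List.getLast?_eq_some_getLast (by simp)⟩
      refine ⟨(a :: y :: A).reverse ++ w :: B, x, x', ?_, hperm.nodup_iff.2 nd, ?_, ?_, ?_, ?_, ?_⟩
      · refine List.isChain_append.2 ⟨chain_rev G hc.left_of_append, hc.right_of_append, ?_⟩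
        simpa using hw
      · rw [hperm.length_eq]; exact hmax
      · rw [List.head?_append_of_ne_nil _ (by simp), List.head?_reverse, List.getLast?_cons_cons, hx]
      · rw [List.getLast?_append_of_ne_nil _ (by simp), hx']
      · rintro rfl
        have := List.mem_of_getLast? hx
        have h2 := (nd_split nd).1
        exact (List.nodup_cons.1 h2).1 this
      · rintro rfl
        have := List.mem_of_getLast? hx'
        exact (nd_split nd).2.2 x' (by simp) this
  have hP : P ≠ [] := by rintro rfl; simp at hlen
  by_cases h1 : P.head? = some u
  · exact main P hc nd hmax hlen h1
  by_cases h2 : P.getLast? = some u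
  · exact main P.reverse (chain_rev G hc) (List.nodup_reverse.2 nd) (by simpa using hmax)
      (by simpa using hlen) (by simpa using h2)
  refine ⟨P, P.head hP, P.getLast hP, hc, nd, hmax, List.head?_eq_some_head hP,
    List.getLast?_eq_some_getLast hP, ?_, ?_⟩
  · rintro h; rw [List.head?_eq_some_head hP, h] at h1; exact h1 rfl
  · rintro h; rw [List.getLast?_eq_some_getLast hP, h] at h2; exact h2 rfl

theorem walk_of_list (G : SimpleGraph V) (u : V) (B : List V) (hc : (u :: B).IsChain G.Adj) :
    ∃ (w : V) (p : G.Walk u w), p.support = u :: B := by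
  induction B generalizing u with
  | nil => exact ⟨u, Walk.nil, by simp⟩
  | cons b B ih =>
    obtain ⟨h1, h2⟩ := List.isChain_cons_cons.1 hc
    obtain ⟨w, p, hp⟩ := ih b h2
    exact ⟨w, Walk.cons h1 p, by simp [hp]⟩

theorem rooted_list [Fintype V] (G : SimpleGraph V) (hG : TwoConnected G) (u : V) (l : List V)
    (hl : Cyc G l) (hne : l ≠ []) :
    ∃ B, (u :: B).IsChain G.Adj ∧ (u :: B).Nodup ∧ l.length ≤ (u :: B).length := by
  by_cases hu : u ∈ l
  · obtain ⟨B, h1, h2⟩ := hl.rotate hu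
    exact ⟨B, h1, h2.nodup_iff.2 hl.1, h2.length_eq.ge⟩
  · obtain ⟨y0, hy0⟩ := List.exists_mem_of_ne_nil l hne
    obtain ⟨c, M, y, b1, b2, b3, b4, b5, b6⟩ := bridge G ∅ (hG.2 ∅ (by simp)) {u} {v | v ∈ l}
      u y0 (by simp) (by simp) rfl hy0 (by rintro v rfl; exact hu)
    simp only [Set.mem_singleton_iff] at b4
    subst b4
    obtain ⟨B, h1, h2⟩ := hl.rotate b5
    refine ⟨M ++ y :: B, chain_join G (A := c :: M) (by simpa using b1) h1, ?_, ?_⟩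
    · have := nd_join (X := []) (by simp) b2 (h2.nodup_iff.2 hl.1) (fun v hv => ⟨by simp, ?_⟩)
        (by simp)
      · simpa using this
      · rw [h2.mem_iff]
        rcases List.mem_cons.1 hv with rfl | hv
        · exact hu
        · exact (b6 v hv).2
    · have := h2.length_eq
      simp at this ⊢
      omega

end Rooted

theorem stmt_2 {V : Type*} [Fintype V] [DecidableEq V] (G : SimpleGraph V)
    [DecidableRel G.Adj] (h : ℕ) (hh : 2 ≤ h) (hG : TwoConnected G) (u : V)
    (hd : ∀ v, v ≠ u → h ≤ G.degree v) :
    ∃ (w : V) (p : G.Walk u w), p.IsPath ∧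
      p.support.length = min (Fintype.card V) (2 * h) := by
  obtain ⟨P, x, x', hc, nd, hmax, hx, hx', hxu, hxu'⟩ := Rooted.exists_longest G hG u
  obtain ⟨l, hl, hlen⟩ := Rooted.dirac G h hh hG P x x' hc nd hmax hx hx' (hd x hxu) (hd x' hxu')
  have h3 := hG.1
  have hpos : 0 < min (Fintype.card V) (2 * h) := by
    rw [lt_min_iff]; omega
  obtain ⟨B, h1, h2, h4⟩ := Rooted.rooted_list G hG u l hl (by rintro rfl; simp at hlen; omega)
  obtain ⟨k, hk⟩ := Nat.exists_eq_succ_of_ne_zero hpos.ne'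
  obtain ⟨w, p, hp⟩ := Rooted.walk_of_list G u (B.take k) (by simpa using h1.take (k + 1))
  refine ⟨w, p, ?_, ?_⟩
  · rw [SimpleGraph.Walk.isPath_def, hp]
    have := h2.sublist (List.take_sublist (k + 1) _)
    simpa using this
  · rw [hp]
    simp at h4 ⊢
    rw [hk] at hlen ⊢
    omega
end

section
/- Let G be a 2-connected graph on at least 2h vertices with minimum degree at least h ≥ 2. Then G contains a cycle of length at least 2h. -/
open SimpleGraph

def HP {V : Type*} [DecidableEq V] (G : SimpleGraph V) (x y : V) (S : Finset V) : Prop :=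
  ∃ p : G.Walk x y, p.IsPath ∧ p.support.toFinset = S

namespace HP
variable {V : Type*} [DecidableEq V] {G : SimpleGraph V} {x y z w : V} {S T : Finset V}

lemma single (x : V) : HP G x x {x} := ⟨.nil, by simp, by simp⟩

lemma symm (h : HP G x y S) : HP G y x S := by
  obtain ⟨p, hp, rfl⟩ := h
  exact ⟨p.reverse, hp.reverse, by simp⟩

lemma left_mem (h : HP G x y S) : x ∈ S := by
  obtain ⟨p, hp, rfl⟩ := h; simp

lemma right_mem (h : HP G x y S) : y ∈ S := by
  obtain ⟨p, hp, rfl⟩ := h; simp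

lemma cons (a : G.Adj z x) (h : HP G x y S) (hz : z ∉ S) : HP G z y (insert z S) := by
  obtain ⟨p, hp, rfl⟩ := h
  refine ⟨.cons a p, ?_, by simp⟩
  rw [Walk.cons_isPath_iff]
  exact ⟨hp, by simpa using hz⟩

lemma tail (h : HP G x y S) (hxy : x ≠ y) :
    ∃ x', G.Adj x x' ∧ HP G x' y (S.erase x) := by
  obtain ⟨p, hp, rfl⟩ := h
  cases p with
  | nil => exact absurd rfl hxy
  | cons a q =>
    rw [Walk.cons_isPath_iff] at hp
    refine ⟨_, a, q, hp.1, ?_⟩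
    rw [Walk.support_cons, List.toFinset_cons, Finset.erase_insert]
    simpa using hp.2

lemma join (h : HP G x y S) (h' : HP G z w T) (a : G.Adj y z) (hd : Disjoint S T) :
    HP G x w (S ∪ T) := by
  obtain ⟨p, hp, rfl⟩ := h
  induction p with
  | nil =>
    simp only [Walk.support_nil, List.toFinset_cons, List.toFinset_nil] at hd ⊢
    have := cons a h' (by simpa using hd)
    convert this using 1
    ext t; simp
  | cons b q ih =>
    rw [Walk.cons_isPath_iff] at hp
    simp only [Walk.support_cons, List.toFinset_cons, Finset.disjoint_insert_left] at hd ⊢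
    rw [Finset.insert_union]
    refine cons b (ih a hp.1 hd.2) ?_
    simp only [Finset.mem_union, List.mem_toFinset, not_or]
    exact ⟨hp.2, hd.1⟩

lemma join' (h : HP G x y S) (h' : HP G y w T) (hd : ∀ t ∈ S, t ∈ T → t = y) :
    HP G x w (S ∪ T) := by
  by_cases e : y = w
  · subst e
    obtain ⟨p, hp, rfl⟩ := h'
    have : p = .nil := (Walk.eq_nil_iff_nil).2 (Walk.isPath_iff_nil.1 hp)
    subst this
    convert h using 1
    simpa using h.right_mem
  · obtain ⟨y', a, h2⟩ := h'.tail e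
    have := h.join h2 a (by
      rw [Finset.disjoint_left]; intro t ht ht'
      rw [Finset.mem_erase] at ht'
      exact ht'.1 (hd t ht ht'.2))
    convert this using 1
    ext t
    have := h.right_mem
    simp only [Finset.mem_union, Finset.mem_erase]
    by_cases t = y <;> grind

lemma split (h : HP G x y S) (hz : z ∈ S) :
    ∃ S', S' ⊆ S ∧ HP G x z S' ∧ (z ≠ y → y ∉ S') := by
  obtain ⟨p, hp, rfl⟩ := h
  have hz' : z ∈ p.support := by simpa using hz
  refine ⟨(p.takeUntil z hz').support.toFinset, ?_, ⟨_, hp.takeUntil hz', rfl⟩, ?_⟩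
  · intro t ht
    rw [List.mem_toFinset] at *
    exact p.support_takeUntil_subset_support hz' ht
  · intro hne hy
    rw [List.mem_toFinset] at hy
    exact Walk.endpoint_notMem_support_takeUntil hp hz' hne.symm hy

lemma cycle (h : HP G x y S) (a : G.Adj y x) (hc : 3 ≤ S.card) :
    ∃ (v : V) (c : G.Walk v v), c.IsCycle ∧ c.length = S.card := by
  obtain ⟨p, hp, rfl⟩ := h
  have hl : p.support.toFinset.card = p.length + 1 := by
    rw [List.toFinset_card_of_nodup hp.support_nodup, Walk.length_support]
  rw [hl] at hc ⊢
  refine ⟨y, .cons a p, ?_, by simp⟩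
  rw [Walk.cons_isCycle_iff]
  refine ⟨hp, fun he => ?_⟩
  cases p with
  | nil => simp at hc
  | @cons _ x' _ b q =>
    rw [Walk.cons_isPath_iff] at hp
    rw [Walk.edges_cons, List.mem_cons] at he
    rcases he with he | he
    · have : y = x' := by
        rw [Sym2.eq_iff] at he
        rcases he with he | he
        · exact absurd he.1 a.ne
        · exact he.1
      subst this
      have := (Walk.eq_nil_iff_nil).2 (Walk.isPath_iff_nil.1 hp.1)
      subst this
      simp at hc
    · exact hp.2 (Walk.snd_mem_support_of_mem_edges _ he)

lemma glue (h : HP G x y S) (h' : HP G x y T) (hxy : x ≠ y)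
    (hd : ∀ t ∈ S, t ∈ T → t = x ∨ t = y) (hc : 3 ≤ (S ∪ T).card) :
    ∃ (v : V) (c : G.Walk v v), c.IsCycle ∧ c.length = (S ∪ T).card := by
  obtain ⟨x', a, h2⟩ := h'.tail hxy
  have h3 := h.join' h2.symm (by grind)
  have e : S ∪ T.erase x = S ∪ T := by
    have := h.left_mem
    ext t; simp only [Finset.mem_union, Finset.mem_erase]
    by_cases t = x <;> grind
  rw [e] at h3
  exact h3.cycle a.symm hc

lemma seq {v : ℕ → V} {i j : ℕ} (hij : i ≤ j) (ha : ∀ k, i ≤ k → k < j → G.Adj (v k) (v (k+1)))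
    (hv : Set.InjOn v (Set.Icc i j)) : HP G (v i) (v j) ((Finset.Icc i j).image v) := by
  induction j, hij using Nat.le_induction with
  | base => simpa using single (v i)
  | succ j hij ih =>
    have h1 := ih (fun k h1 h2 => ha k h1 (by omega))
      (hv.mono (Set.Icc_subset_Icc_right (by omega)))
    have h2 := (h1.symm.cons (z := v (j+1)) (ha j hij (by omega)).symm (by
      simp only [Finset.mem_image, Finset.mem_Icc, not_exists, not_and]
      intro k hk he
      have := hv (by simp; omega) (by simp; omega) he
      omega)).symm
    convert h2 using 1
    rw [← Finset.image_insert]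
    congr 1
    ext; simp; omega

lemma exists_link [Fintype V] (hG : ∀ w : V, (G.induce ({w}ᶜ : Set V)).Connected)
    (U B : Finset V) (w : V) (hU : ∃ u ∈ U, u ≠ w) (hB : ∃ u ∈ B, u ≠ w) :
    ∃ z ∈ U, ∃ g ∈ B, ∃ R, HP G z g R ∧ w ∉ R ∧ (∀ t ∈ R, t ∈ U → t = z) ∧
      (∀ t ∈ R, t ∈ B → t = g) := by
  classical
  have ex : ∃ n : ℕ, ∃ z ∈ U, ∃ g ∈ B, ∃ R, HP G z g R ∧ w ∉ R ∧ R.card = n := by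
    obtain ⟨u, hu, huw⟩ := hU
    obtain ⟨b, hb, hbw⟩ := hB
    have huw' : u ∈ ({w}ᶜ : Set V) := huw
    have hbw' : b ∈ ({w}ᶜ : Set V) := hbw
    obtain ⟨p, hp⟩ := (hG w).exists_isPath ⟨u, huw'⟩ ⟨b, hbw'⟩
    refine ⟨_, u, hu, b, hb, _, ⟨p.map (Embedding.induce (G := G) ({w}ᶜ : Set V)).toHom, ?_, rfl⟩, ?_, rfl⟩
    · exact hp.map (Embedding.induce (G := G) ({w}ᶜ : Set V)).injective
    · intro hm
      have hm := List.mem_toFinset.1 hm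
      erw [Walk.support_map, List.mem_map] at hm
      obtain ⟨t, _, ht⟩ := hm
      exact t.2 ht
  obtain ⟨z, hz, g, hg, R, hR, hw, hn⟩ := Nat.find_spec ex
  have hmin := fun m (hm : m < Nat.find ex) => Nat.find_min ex hm
  rw [← hn] at hmin
  refine ⟨z, hz, g, hg, R, hR, hw, ?_, ?_⟩
  · intro t ht htU
    by_contra hne
    obtain ⟨S', hS, h', hy⟩ := hR.symm.split ht
    refine hmin S'.card (Finset.card_lt_card ⟨hS, fun h => hy hne (h hR.left_mem)⟩)
      ⟨t, htU, g, hg, S', h'.symm, fun h => hw (hS h), rfl⟩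
  · intro t ht htU
    by_contra hne
    obtain ⟨S', hS, h', hy⟩ := hR.split ht
    refine hmin S'.card (Finset.card_lt_card ⟨hS, fun h => hy hne (h hR.right_mem)⟩)
      ⟨z, hz, t, htU, S', h', fun h => hw (hS h), rfl⟩

end HP

def Leg {V : Type*} [DecidableEq V] (G : SimpleGraph V) (v : ℕ → V) (a m s e : ℕ) (T : Finset V)
    (c : ℕ) : Prop :=
  HP G (v s) (v e) T ∧ (∀ i ≤ a, v i ∈ T → i = s) ∧ (∀ i, c ≤ i → i ≤ m → v i ∈ T → i = e)

def Two {V : Type*} [DecidableEq V] (G : SimpleGraph V) (v : ℕ → V) (a m c : ℕ) : Prop :=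
  ∃ s1 s2 e2 T1 T2, Leg G v a m s1 c T1 c ∧ Leg G v a m s2 e2 T2 c ∧ Disjoint T1 T2 ∧
    s1 ≤ a ∧ s2 ≤ a ∧ (s1 = a ∨ s2 = a) ∧ c < e2 ∧ e2 ≤ m

section
variable {V : Type*} [DecidableEq V] {G : SimpleGraph V} {v : ℕ → V} {a m c : ℕ}

lemma Leg.ext' {s : ℕ} {T : Finset V} (h : Leg G v a m s c T c)
    (hadj : ∀ k < m, G.Adj (v k) (v (k+1)))
    (hinj : ∀ i ≤ m, ∀ j ≤ m, v i = v j → i = j) (hac : a ≤ c) (hcm : c + 1 < m) :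
    Leg G v a m s (c+1) (insert (v (c+1)) T) (c+1) := by
  obtain ⟨h1, h2, h3⟩ := h
  refine ⟨(h1.symm.cons (hadj c (by omega)).symm ?_).symm, ?_, ?_⟩
  · intro hm
    have := h3 _ (by omega) (by omega) hm
    omega
  · intro i hi hm
    rw [Finset.mem_insert] at hm
    rcases hm with hm | hm
    · have := hinj _ (by omega) _ (by omega) hm
      omega
    · exact h2 i hi hm
  · intro i hi him hm
    rw [Finset.mem_insert] at hm
    rcases hm with hm | hm
    · exact hinj _ (by omega) _ (by omega) hm
    · have := h3 i (by omega) him hm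
      omega

lemma Leg.mono {s e : ℕ} {T : Finset V} (h : Leg G v a m s e T c) : Leg G v a m s e T (c+1) :=
  ⟨h.1, h.2.1, fun i hi => h.2.2 i (by omega)⟩

lemma Leg.reroute {s e g : ℕ} {T R U : Finset V} {z : V} (h : Leg G v a m s e T c)
    (hinj : ∀ i ≤ m, ∀ j ≤ m, v i = v j → i = j)
    (hR : HP G z (v g) R) (hgm : g ≤ m)
    (hU : ∀ t ∈ R, t ∈ U → t = z) (hTU : T ⊆ U) (hA : ∀ i ≤ a, v i ∈ U)
    (hB : ∀ i, c + 1 < i → i ≤ m → v i ∈ R → v i = v g) (hw : v (c+1) ∉ R)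
    (hz : z ∈ T) (he : e = c ∨ e = c+1) :
    ∃ T' ⊆ T, (z ≠ v e → v e ∉ T') ∧ Leg G v a m s g (T' ∪ R) (c+1) := by
  obtain ⟨h1, h2, h3⟩ := h
  obtain ⟨T', hT', hp, hne⟩ := h1.split hz
  refine ⟨T', hT', hne, hp.join' hR fun t ht ht' => hU t ht' (hTU (hT' ht)), ?_, ?_⟩
  · intro i hi hm
    rw [Finset.mem_union] at hm
    rcases hm with hm | hm
    · exact h2 i hi (hT' hm)
    · have := hU _ hm (hA i hi)
      exact h2 i hi (this ▸ hz)
  · intro i hi him hm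
    rw [Finset.mem_union] at hm
    rcases hm with hm | hm
    · have h4 := h3 i (by omega) him (hT' hm)
      have h5 : e = c + 1 := by omega
      have : i = e := h4
      subst h4
      subst h5
      exfalso
      refine hne ?_ hm
      rintro rfl
      exact hw hR.left_mem
    · have : i ≠ c + 1 := by rintro rfl; exact hw hm
      exact hinj _ him _ hgm (hB i (by omega) him hm)

lemma Two.step [Fintype V] (hG : ∀ w : V, (G.induce ({w}ᶜ : Set V)).Connected)
    (hadj : ∀ k < m, G.Adj (v k) (v (k+1)))
    (hinj : ∀ i ≤ m, ∀ j ≤ m, v i = v j → i = j) (hac : a ≤ c) (hcm : c + 1 < m)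
    (h : Two G v a m c) : Two G v a m (c+1) := by
  obtain ⟨s1, s2, e2, T1, T2, L1, L2, hd, hs1, hs2, hs, hce, hem⟩ := h
  have L1' := L1.ext' hadj hinj hac hcm
  rw [Finset.disjoint_left] at hd
  by_cases he : e2 = c + 1
  swap
  · refine ⟨s1, s2, e2, _, T2, L1', L2.mono, ?_, hs1, hs2, hs, by omega, hem⟩
    rw [Finset.disjoint_insert_left, Finset.disjoint_left]
    exact ⟨fun hm => he (L2.2.2 _ (by omega) (by omega) hm).symm, hd⟩
  subst he
  obtain ⟨z, hz, g', hg, R, hR, hw, hU, hB⟩ := HP.exists_link hG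
    ((Finset.Icc 0 a).image v ∪ T1 ∪ T2) ((Finset.Icc (c+2) m).image v) (v (c+1))
    ⟨v a, by simp only [Finset.mem_union, Finset.mem_image, Finset.mem_Icc]; left; left; exact ⟨a, by simp, rfl⟩,
      fun h => by have := hinj _ (by omega) _ (by omega) h; omega⟩
    ⟨v m, by simp only [Finset.mem_image, Finset.mem_Icc]; exact ⟨m, by omega, rfl⟩,
      fun h => by have := hinj _ (by omega) _ (by omega) h; omega⟩
  rw [Finset.mem_image] at hg
  obtain ⟨g, hg, rfl⟩ := hg
  rw [Finset.mem_Icc] at hg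
  have hA : ∀ i ≤ a, v i ∈ (Finset.Icc 0 a).image v ∪ T1 ∪ T2 := by
    intro i hi
    simp only [Finset.mem_union, Finset.mem_image, Finset.mem_Icc]
    left; left; exact ⟨i, by omega, rfl⟩
  have hB' : ∀ i, c + 1 < i → i ≤ m → v i ∈ R → v i = v g := by
    intro i hi him hm
    exact hB _ hm (Finset.mem_image_of_mem _ (by simp; omega))
  have hT1 : T1 ⊆ (Finset.Icc 0 a).image v ∪ T1 ∪ T2 := by intro t ht; simp [ht]
  have hT2 : T2 ⊆ (Finset.Icc 0 a).image v ∪ T1 ∪ T2 := by intro t ht; simp [ht]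
  by_cases z1 : z ∈ T1
  · obtain ⟨T', hT', -, L⟩ := L1.reroute hinj hR hg.2 hU hT1 hA hB' hw z1 (.inl rfl)
    refine ⟨s2, s1, g, T2, _, L2.mono, L, ?_, hs2, hs1, hs.symm, by omega, hg.2⟩
    rw [Finset.disjoint_left]
    intro t ht ht'
    rw [Finset.mem_union] at ht'
    rcases ht' with ht' | ht'
    · exact hd (hT' ht') ht
    · exact hd z1 (hU t ht' (hT2 ht) ▸ ht)
  by_cases z2 : z ∈ T2
  · obtain ⟨T', hT', hne, L⟩ := L2.reroute hinj hR hg.2 hU hT2 hA hB' hw z2 (.inr rfl)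
    have hzw : z ≠ v (c+1) := by rintro rfl; exact hw hR.left_mem
    refine ⟨s1, s2, g, _, _, L1', L, ?_, hs1, hs2, hs, by omega, hg.2⟩
    rw [Finset.disjoint_left]
    intro t ht ht'
    rw [Finset.mem_union] at ht'
    rw [Finset.mem_insert] at ht
    rcases ht with rfl | ht
    · exact ht'.elim (hne hzw) hw
    rcases ht' with ht' | ht'
    · exact hd ht (hT' ht')
    · exact z1 (hU t ht' (hT1 ht) ▸ ht)
  simp only [Finset.mem_union, z1, z2, or_false, Finset.mem_image, Finset.mem_Icc] at hz
  obtain ⟨i, hi, rfl⟩ := hz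
  have L : Leg G v a m i g R (c+1) := by
    refine ⟨hR, ?_, ?_⟩
    · intro k hk hm
      exact hinj _ (by omega) _ (by omega) (hU _ hm (hA k hk))
    · intro k hk hkm hm
      have : k ≠ c + 1 := by rintro rfl; exact hw hm
      exact hinj _ hkm _ hg.2 (hB' k (by omega) hkm hm)
  rcases hs with rfl | rfl
  · refine ⟨_, i, g, _, _, L1', L, ?_, hs1, hi.2, .inl rfl, by omega, hg.2⟩
    rw [Finset.disjoint_left]
    intro t ht ht'
    rw [Finset.mem_insert] at ht
    rcases ht with rfl | ht
    · exact hw ht'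
    · exact z1 (hU t ht' (hT1 ht) ▸ ht)
  · refine ⟨_, i, g, _, _, L2.mono, L, ?_, hs2, hi.2, .inl rfl, by omega, hg.2⟩
    rw [Finset.disjoint_left]
    intro t ht ht'
    exact z2 (hU t ht' (hT2 ht) ▸ ht)

lemma Two.base [Fintype V] (hG : ∀ w : V, (G.induce ({w}ᶜ : Set V)).Connected)
    (hinj : ∀ i ≤ m, ∀ j ≤ m, v i = v j → i = j) (ha : 0 < a) (ham : a < m) :
    Two G v a m a := by
  obtain ⟨z, hz, g', hg, R, hR, hw, hU, hB⟩ := HP.exists_link hG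
    ((Finset.Ico 0 a).image v) ((Finset.Icc (a+1) m).image v) (v a)
    ⟨v 0, Finset.mem_image_of_mem _ (by simp; omega),
      fun h => by have := hinj _ (by omega) _ (by omega) h; omega⟩
    ⟨v m, Finset.mem_image_of_mem _ (by simp; omega),
      fun h => by have := hinj _ (by omega) _ (by omega) h; omega⟩
  rw [Finset.mem_image] at hg hz
  obtain ⟨g, hg, rfl⟩ := hg
  obtain ⟨s, hs, rfl⟩ := hz
  rw [Finset.mem_Icc] at hg
  rw [Finset.mem_Ico] at hs
  refine ⟨a, s, g, {v a}, R, ⟨HP.single _, ?_, ?_⟩, ⟨hR, ?_, ?_⟩, by simpa using hw, le_rfl,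
    by omega, .inl rfl, by omega, hg.2⟩
  · intro i hi hm
    exact hinj _ (by omega) _ (by omega) (Finset.mem_singleton.1 hm)
  · intro i hi him hm
    exact hinj _ (by omega) _ (by omega) (Finset.mem_singleton.1 hm)
  · intro i hi hm
    have : i ≠ a := by rintro rfl; exact hw hm
    exact hinj _ (by omega) _ (by omega) (hU _ hm (Finset.mem_image_of_mem _ (by simp; omega)))
  · intro i hi him hm
    have : i ≠ a := by rintro rfl; exact hw hm
    exact hinj _ (by omega) _ (by omega) (hB _ hm (Finset.mem_image_of_mem _ (by simp; omega)))

lemma two_all [Fintype V] (hG : ∀ w : V, (G.induce ({w}ᶜ : Set V)).Connected)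
    (hadj : ∀ k < m, G.Adj (v k) (v (k+1)))
    (hinj : ∀ i ≤ m, ∀ j ≤ m, v i = v j → i = j) (ha : 0 < a) (hac : a ≤ c) (hcm : c < m) :
    Two G v a m c := by
  induction c, hac using Nat.le_induction with
  | base => exact Two.base hG hinj ha hcm
  | succ c hc ih => exact Two.step hG hadj hinj hc hcm (ih (by omega))

lemma seg (hadj : ∀ k < m, G.Adj (v k) (v (k+1)))
    (hinj : ∀ i ≤ m, ∀ j ≤ m, v i = v j → i = j) {i j : ℕ} (hij : i ≤ j) (hj : j ≤ m) :
    HP G (v i) (v j) ((Finset.Icc i j).image v) :=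
  HP.seq hij (fun k _ h => hadj k (by omega)) (fun x hx y hy h => hinj x (hx.2.trans hj) y (hy.2.trans hj) h)

/-- path on `[0,i] ∪ [j,k]` from `v i` to `v k` using the chord `v 0 v j` -/
lemma seg0 (hadj : ∀ k < m, G.Adj (v k) (v (k+1)))
    (hinj : ∀ i ≤ m, ∀ j ≤ m, v i = v j → i = j) {i j k : ℕ} (hij : i < j) (hjk : j ≤ k)
    (hk : k ≤ m) (h : G.Adj (v 0) (v j)) :
    HP G (v i) (v k) ((Finset.Icc 0 i ∪ Finset.Icc j k).image v) := by
  rw [Finset.image_union]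
  refine (seg hadj hinj (Nat.zero_le i) (by omega)).symm.join (seg hadj hinj hjk hk) h ?_
  rw [Finset.disjoint_left]
  intro t ht ht'
  rw [Finset.mem_image] at ht ht'
  obtain ⟨p, hp, rfl⟩ := ht
  obtain ⟨q, hq, he⟩ := ht'
  rw [Finset.mem_Icc] at hp hq
  have := hinj _ (by omega) _ (by omega) he
  omega

/-- path on `[i,j] ∪ [k,m]` from `v i` to `v k` using the chord `v m v j` -/
lemma segm (hadj : ∀ k < m, G.Adj (v k) (v (k+1)))
    (hinj : ∀ i ≤ m, ∀ j ≤ m, v i = v j → i = j) {i j k : ℕ} (hij : i ≤ j) (hjk : j < k)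
    (hk : k ≤ m) (h : G.Adj (v m) (v j)) :
    HP G (v i) (v k) ((Finset.Icc i j ∪ Finset.Icc k m).image v) := by
  rw [Finset.image_union]
  refine (seg hadj hinj hij (by omega)).join (seg hadj hinj hk le_rfl).symm h.symm ?_
  rw [Finset.disjoint_left]
  intro t ht ht'
  rw [Finset.mem_image] at ht ht'
  obtain ⟨p, hp, rfl⟩ := ht
  obtain ⟨q, hq, he⟩ := ht'
  rw [Finset.mem_Icc] at hp hq
  have := hinj _ (by omega) _ (by omega) he
  omega

lemma caseB (hadj : ∀ k < m, G.Adj (v k) (v (k+1)))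
    (hinj : ∀ i ≤ m, ∀ j ≤ m, v i = v j → i = j) (h : ℕ) (hh : 2 ≤ h) (I J : Finset ℕ)
    (hI : ∀ i, i ∈ I ↔ i ≤ m ∧ G.Adj (v 0) (v i)) (hJ : ∀ i, i ∈ J ↔ i ≤ m ∧ G.Adj (v m) (v i))
    (hIc : h ≤ I.card) (hJc : h ≤ J.card) (hno : ∀ i ∈ J, i + 1 ∉ I)
    (hcr : ∃ i ∈ J, ∃ j ∈ I, i < j) :
    ∃ (v : V) (c : G.Walk v v), c.IsCycle ∧ 2 * h ≤ c.length := by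
  classical
  have ex : ∃ d : ℕ, ∃ i ∈ J, ∃ j ∈ I, i < j ∧ j - i = d := by
    obtain ⟨i, hi, j, hj, h⟩ := hcr
    exact ⟨_, i, hi, j, hj, h, rfl⟩
  obtain ⟨i, hi, j, hj, hij, hd⟩ := Nat.find_spec ex
  have hmin := fun m (hm : m < Nat.find ex) => Nat.find_min ex hm
  rw [← hd] at hmin
  have h1 : ∀ k ∈ I, k ≤ i ∨ j ≤ k := by
    intro k hk
    by_contra! hc
    exact hmin (k - i) (by omega) ⟨i, hi, k, hk, by omega, rfl⟩
  have h2 : ∀ k ∈ J, k ≤ i ∨ j ≤ k := by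
    intro k hk
    by_contra! hc
    exact hmin (j - k) (by omega) ⟨k, hk, j, hj, by omega, rfl⟩
  have him := (hI j).1 hj
  have hp := seg0 hadj hinj hij him.1 le_rfl him.2
  have hm' : m ∉ J := fun h => ((hJ m).1 h).2.ne rfl
  have h0' : 0 ∉ I := fun h => ((hI 0).1 h).2.ne rfl
  have hcard : 2 * h ≤ ((Finset.Icc 0 i ∪ Finset.Icc j m).image v).card := by
    rw [Finset.card_image_of_injOn]
    · have hsub : insert 0 I ∪ (J.erase i).image (· + 1) ⊆ Finset.Icc 0 i ∪ Finset.Icc j m := by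
        intro t ht
        simp only [Finset.mem_union, Finset.mem_insert, Finset.mem_image, Finset.mem_erase,
          Finset.mem_Icc] at ht ⊢
        rcases ht with (rfl | ht) | ⟨k, ⟨hk, hkJ⟩, rfl⟩
        · omega
        · have := h1 t ht
          have := ((hI t).1 ht).1
          omega
        · have := h2 k hkJ
          have := ((hJ k).1 hkJ).1
          have : k ≠ m := by rintro rfl; exact hm' hkJ
          omega
      refine le_trans ?_ (Finset.card_le_card hsub)
      rw [Finset.card_union_of_disjoint, Finset.card_insert_of_notMem h0',
        Finset.card_image_of_injective _ (add_left_injective 1), Finset.card_erase_of_mem hi]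
      · omega
      · rw [Finset.disjoint_left]
        intro t ht ht'
        simp only [Finset.mem_insert, Finset.mem_image, Finset.mem_erase] at ht ht'
        obtain ⟨k, ⟨hk, hkJ⟩, rfl⟩ := ht'
        rcases ht with ht | ht
        · omega
        · exact hno k hkJ ht
    · intro x hx y hy hxy
      simp only [Finset.coe_union, Finset.coe_Icc, Set.mem_union, Set.mem_Icc] at hx hy
      exact hinj x (by omega) y (by omega) hxy
  obtain ⟨u, c, hc, hl⟩ := hp.cycle ((hJ i).1 hi).2 (by omega)
  exact ⟨u, c, hc, by omega⟩

lemma finale {p q r t : V} {X Y T T' : Finset V} (hX : HP G p q X) (hT : HP G q r T)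
    (hY : HP G r t Y) (hT' : HP G p t T') (hpt : p ≠ t) (hd : Disjoint T T')
    (h1 : ∀ x ∈ X, x ∈ T → x = q) (h2 : ∀ x ∈ T, x ∈ Y → x = r) (h3 : ∀ x ∈ X, x ∈ Y → x = r)
    (h4 : ∀ x ∈ X, x ∈ T' → x = p) (h5 : ∀ x ∈ Y, x ∈ T' → x = t) {n : ℕ} (hn : 3 ≤ n)
    (hc : n ≤ (X ∪ Y).card) :
    ∃ (v : V) (c : G.Walk v v), c.IsCycle ∧ n ≤ c.length := by
  rw [Finset.disjoint_left] at hd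
  have h6 := (hX.join' hT h1).join' hY (by
    intro x hx; rw [Finset.mem_union] at hx; exact hx.elim (h3 x) (h2 x))
  have hcc : n ≤ (X ∪ T ∪ Y ∪ T').card :=
    hc.trans (Finset.card_le_card (by intro x hx; simp only [Finset.mem_union] at *; tauto))
  obtain ⟨u, c, hc, hl⟩ := h6.glue hT' hpt (by
    intro x hx hx'
    simp only [Finset.mem_union] at hx
    rcases hx with (hx | hx) | hx
    · exact .inl (h4 x hx hx')
    · exact absurd hx' (hd hx)
    · exact .inr (h5 x hx hx')) (by omega)
  exact ⟨u, c, hc, by omega⟩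

lemma caseC [Fintype V] (hG : ∀ w : V, (G.induce ({w}ᶜ : Set V)).Connected)
    (hadj : ∀ k < m, G.Adj (v k) (v (k+1)))
    (hinj : ∀ i ≤ m, ∀ j ≤ m, v i = v j → i = j) (h : ℕ) (hh : 2 ≤ h) (I J : Finset ℕ)
    (hI : ∀ i, i ∈ I ↔ i ≤ m ∧ G.Adj (v 0) (v i)) (hJ : ∀ i, i ∈ J ↔ i ≤ m ∧ G.Adj (v m) (v i))
    (hIc : h ≤ I.card) (hJc : h ≤ J.card)
    (hcr : ∀ i ∈ J, ∀ j ∈ I, j ≤ i) :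
    ∃ (v : V) (c : G.Walk v v), c.IsCycle ∧ 2 * h ≤ c.length := by
  classical
  have hm' : m ∉ J := fun h => ((hJ m).1 h).2.ne rfl
  have h0' : 0 ∉ I := fun h => ((hI 0).1 h).2.ne rfl
  have hIne : I.Nonempty := Finset.card_pos.1 (by omega)
  have hJne : J.Nonempty := Finset.card_pos.1 (by omega)
  obtain ⟨a, haI, hamax⟩ := I.exists_max_image id hIne
  obtain ⟨b, hbJ, hbmin⟩ := J.exists_min_image id hJne
  simp only [id] at hamax hbmin
  have hab := hcr b hbJ a haI
  have ha0 : a ≠ 0 := by rintro rfl; exact h0' haI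
  have hbm : b ≠ m := by rintro rfl; exact hm' hbJ
  have hbm' := ((hJ b).1 hbJ).1
  have key : ∀ s e, s < a → b < e → e ≤ m → ∃ X Y : Finset V, HP G (v s) (v a) X ∧
      HP G (v b) (v e) Y ∧ (∀ x ∈ X, ∃ i ≤ a, v i = x) ∧
      (∀ x ∈ Y, ∃ i, b ≤ i ∧ i ≤ m ∧ v i = x) ∧ 2 * h ≤ (X ∪ Y).card := by
    intro s e hs he hem
    obtain ⟨j, hj, hjmin⟩ := (I.filter (s < ·)).exists_min_image id ⟨a, by simp [haI, hs]⟩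
    obtain ⟨k, hk, hkmax⟩ := (J.filter (· < e)).exists_max_image id ⟨b, by simp [hbJ, he]⟩
    simp only [id, Finset.mem_filter] at hj hjmin hk hkmax
    refine ⟨_, _, seg0 hadj hinj hj.2 (hamax j hj.1) (by omega) ((hI j).1 hj.1).2,
      segm hadj hinj (hbmin k hk.1) hk.2 hem ((hJ k).1 hk.1).2, ?_, ?_, ?_⟩
    · intro x hx
      obtain ⟨i, hi, rfl⟩ := Finset.mem_image.1 hx
      simp only [Finset.mem_union, Finset.mem_Icc] at hi
      exact ⟨i, by omega, rfl⟩
    · intro x hx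
      obtain ⟨i, hi, rfl⟩ := Finset.mem_image.1 hx
      simp only [Finset.mem_union, Finset.mem_Icc] at hi
      exact ⟨i, by omega, by omega, rfl⟩
    · rw [← Finset.image_union, Finset.card_image_of_injOn]
      · have hsub : insert 0 I ∪ J.erase b ⊆
            (Finset.Icc 0 s ∪ Finset.Icc j a) ∪ (Finset.Icc b k ∪ Finset.Icc e m) := by
          intro t ht
          simp only [Finset.mem_union, Finset.mem_insert, Finset.mem_erase,
            Finset.mem_Icc] at ht ⊢
          rcases ht with (rfl | ht) | ⟨-, ht⟩
          · omega
          · have := hamax t ht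
            by_cases hst : s < t
            · have := hjmin t ⟨ht, hst⟩
              omega
            · omega
          · have := hbmin t ht
            have := ((hJ t).1 ht).1
            by_cases hst : t < e
            · have := hkmax t ⟨ht, hst⟩
              omega
            · omega
        refine le_trans ?_ (Finset.card_le_card hsub)
        rw [Finset.card_union_of_disjoint, Finset.card_insert_of_notMem h0',
          Finset.card_erase_of_mem hbJ]
        · omega
        · rw [Finset.disjoint_left]
          intro t ht ht'
          simp only [Finset.mem_insert, Finset.mem_erase] at ht ht'
          have := hbmin t ht'.2
          rcases ht with rfl | ht
          · omega
          · have := hamax t ht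
            omega
      · intro x hx y hy hxy
        simp only [Finset.coe_union, Finset.coe_Icc, Set.mem_union, Set.mem_Icc] at hx hy
        exact hinj x (by omega) y (by omega) hxy
  obtain ⟨s1, s2, e, T1, T2, L1, L2, hd, hs1, hs2, hs, hbe, hem⟩ :=
    two_all (c := b) hG hadj hinj (by omega) hab (by omega)
  have hne : s1 ≠ s2 := by
    rintro rfl
    exact Finset.disjoint_left.1 hd L1.1.left_mem L2.1.left_mem
  by_cases h1 : s1 = a
  · subst h1
    obtain ⟨X, Y, hX, hY, hX', hY', hc⟩ := key s2 e (by omega) hbe hem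
    refine finale hX L1.1 hY L2.1 ?_ hd ?_ ?_ ?_ ?_ ?_ (n := 2 * h) (by omega) hc
    · intro h; have := hinj _ (by omega) _ (by omega) h; omega
    · intro x hx hx'
      obtain ⟨i, hi, rfl⟩ := hX' x hx
      rw [L1.2.1 i hi hx']
    · intro x hx' hx
      obtain ⟨i, hi, him, rfl⟩ := hY' x hx
      rw [L1.2.2 i hi him hx']
    · intro x hx' hx
      obtain ⟨i, hi, him, rfl⟩ := hY' x hx
      obtain ⟨i', hi', he⟩ := hX' _ hx'
      have := hinj _ (by omega) _ (by omega) he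
      congr 1
      omega
    · intro x hx hx'
      obtain ⟨i, hi, rfl⟩ := hX' x hx
      rw [L2.2.1 i hi hx']
    · intro x hx hx'
      obtain ⟨i, hi, him, rfl⟩ := hY' x hx
      rw [L2.2.2 i hi him hx']
  · have h2 : s2 = a := by omega
    subst h2
    have hlt : s2 < b := by
      by_contra hc
      have := L2.2.2 s2 (by omega) (by omega) L2.1.left_mem
      omega
    obtain ⟨X, Y, hX, hY, hX', hY', hc⟩ := key s1 e (by omega) hbe hem
    refine finale hX L2.1 hY.symm L1.1 ?_ hd.symm ?_ ?_ ?_ ?_ ?_ (n := 2 * h) (by omega) hc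
    · intro h; have := hinj _ (by omega) _ (by omega) h; omega
    · intro x hx hx'
      obtain ⟨i, hi, rfl⟩ := hX' x hx
      rw [L2.2.1 i hi hx']
    · intro x hx' hx
      obtain ⟨i, hi, him, rfl⟩ := hY' x hx
      rw [L2.2.2 i hi him hx']
    · intro x hx' hx
      obtain ⟨i, hi, him, rfl⟩ := hY' x hx
      obtain ⟨i', hi', he⟩ := hX' _ hx'
      have := hinj _ (by omega) _ (by omega) he
      omega
    · intro x hx hx'
      obtain ⟨i, hi, rfl⟩ := hX' x hx
      rw [L1.2.1 i hi hx']
    · intro x hx hx'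
      obtain ⟨i, hi, him, rfl⟩ := hY' x hx
      rw [L1.2.2 i hi him hx']

lemma HP.toSeq {x y : V} {S : Finset V} (h : HP G x y S) :
    ∃ (v : ℕ → V) (m : ℕ), v 0 = x ∧ v m = y ∧ (∀ k < m, G.Adj (v k) (v (k+1))) ∧
      (∀ i ≤ m, ∀ j ≤ m, v i = v j → i = j) ∧ S = (Finset.Icc 0 m).image v := by
  obtain ⟨p, hp, rfl⟩ := h
  refine ⟨p.getVert, p.length, by simp, by simp, fun k hk => p.adj_getVert_succ hk,
    fun i hi j hj h => hp.getVert_injOn hi hj h, ?_⟩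
  ext t
  simp only [List.mem_toFinset, Walk.mem_support_iff_exists_getVert, Finset.mem_image,
    Finset.mem_Icc]
  constructor
  · rintro ⟨n, h1, h2⟩; exact ⟨n, ⟨by omega, h2⟩, h1⟩
  · rintro ⟨n, ⟨_, h2⟩, h1⟩; exact ⟨n, h1, h2⟩

lemma HP.rotate {x y w : V} {S : Finset V} (h : HP G x y S) (hxy : G.Adj x y) (hw : w ∈ S) :
    ∃ u, HP G w u S := by
  obtain ⟨v, m, rfl, rfl, hadj, hinj, rfl⟩ := h.toSeq
  obtain ⟨i, hi, rfl⟩ := Finset.mem_image.1 hw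
  rw [Finset.mem_Icc] at hi
  by_cases him : i = m
  · subst him
    exact ⟨_, h.symm⟩
  · refine ⟨v (i+1), ?_⟩
    have := (seg hadj hinj (Nat.zero_le i) hi.2).symm.join
      (seg hadj hinj (show i + 1 ≤ m by omega) le_rfl).symm hxy ?_
    · convert this using 1
      rw [← Finset.image_union]
      congr 1
      ext; simp; omega
    · rw [Finset.disjoint_left]
      intro t ht ht'
      rw [Finset.mem_image] at ht ht'
      obtain ⟨p, hp, rfl⟩ := ht
      obtain ⟨q, hq, he⟩ := ht'
      rw [Finset.mem_Icc] at hp hq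
      have := hinj _ (by omega) _ (by omega) he
      omega

end

theorem stmt_3 {V : Type*} [Fintype V] [DecidableEq V] (G : SimpleGraph V)
    [DecidableRel G.Adj] (h : ℕ) (hh : 2 ≤ h) (hG : TwoConnected G)
    (hn : 2 * h ≤ Fintype.card V) (hδ : ∀ v, h ≤ G.degree v) :
    ∃ (v : V) (c : G.Walk v v), c.IsCycle ∧ 2 * h ≤ c.length := by
  classical
  have hG1 : ∀ w : V, (G.induce ({w}ᶜ : Set V)).Connected := by
    intro w
    have := hG.2 {w} (by simp)
    rwa [Finset.coe_singleton] at this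
  have hconn : G.Preconnected := by
    have := (hG.2 ∅ (by simp)).preconnected
    rw [Finset.coe_empty, Set.compl_empty] at this
    intro x y
    exact (this ⟨x, trivial⟩ ⟨y, trivial⟩).map (Embedding.induce (G := G) Set.univ).toHom
  have hne : Nonempty V := Fintype.card_pos_iff.1 (by omega)
  obtain ⟨x0⟩ := hne
  obtain ⟨S, hS, hmax⟩ := (Finset.univ.filter fun S : Finset V => ∃ x y, HP G x y S).exists_max_image
    Finset.card ⟨{x0}, by simp only [Finset.mem_filter, Finset.mem_univ, true_and]; exact ⟨_, _, HP.single x0⟩⟩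
  simp only [Finset.mem_filter, Finset.mem_univ, true_and] at hS hmax
  obtain ⟨x, y, hp⟩ := hS
  have hend : ∀ x y, HP G x y S → ∀ z, G.Adj x z → z ∈ S := by
    intro x y hp z hz
    by_contra hzS
    have := hmax _ ⟨_, _, hp.cons hz.symm hzS⟩
    rw [Finset.card_insert_of_notMem hzS] at this
    omega
  -- a cycle through all of `S`
  have hfull : ∀ x y, HP G x y S → G.Adj x y →
      ∃ (v : V) (c : G.Walk v v), c.IsCycle ∧ 2 * h ≤ c.length := by
    intro x y hp hxy
    have hall : ∀ z, z ∈ S := by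
      intro z
      obtain ⟨q⟩ := hconn z x
      induction q with
      | nil => exact hp.left_mem
      | cons a q ih =>
        obtain ⟨u, hu⟩ := hp.rotate hxy (ih hp hxy)
        exact hend _ _ hu _ a.symm
    have hc : S = Finset.univ := Finset.eq_univ_of_forall hall
    have hc' : S.card = Fintype.card V := by rw [hc, Finset.card_univ]
    obtain ⟨u, c, hc, hl⟩ := hp.cycle hxy.symm (by omega)
    exact ⟨u, c, hc, by omega⟩
  obtain ⟨v, m, rfl, rfl, hadj, hinj, hSe⟩ := hp.toSeq
  have hcount : ∀ z, (∀ u, G.Adj z u → u ∈ S) →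
      h ≤ ((Finset.Icc 0 m).filter fun i => G.Adj z (v i)).card := by
    intro z hz
    refine (hδ z).trans ?_
    rw [← G.card_neighborFinset_eq_degree]
    refine le_trans (Finset.card_le_card ?_) (Finset.card_image_le (f := v))
    intro u hu
    rw [mem_neighborFinset] at hu
    have := hz u hu
    rw [hSe, Finset.mem_image] at this
    obtain ⟨i, hi, rfl⟩ := this
    exact Finset.mem_image_of_mem _ (Finset.mem_filter.2 ⟨hi, hu⟩)
  have hI := hcount (v 0) (hend _ _ hp)
  have hJ := hcount (v m) (hend _ _ hp.symm)
  set I := (Finset.Icc 0 m).filter fun i => G.Adj (v 0) (v i) with hIdef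
  set J := (Finset.Icc 0 m).filter fun i => G.Adj (v m) (v i) with hJdef
  have hI' : ∀ i, i ∈ I ↔ i ≤ m ∧ G.Adj (v 0) (v i) := by intro i; simp [hIdef]
  have hJ' : ∀ i, i ∈ J ↔ i ≤ m ∧ G.Adj (v m) (v i) := by intro i; simp [hJdef]
  by_cases hA : ∃ i ∈ J, i + 1 ∈ I
  · obtain ⟨i, hi, hi1⟩ := hA
    have h1 := (hI' _).1 hi1
    have := seg0 hadj hinj (Nat.lt_succ_self i) h1.1 le_rfl h1.2
    refine hfull _ _ ?_ ((hJ' i).1 hi).2.symm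
    convert this using 1
    rw [hSe]
    congr 1
    ext t; simp; omega
  · push Not at hA
    by_cases hB : ∃ i ∈ J, ∃ j ∈ I, i < j
    · exact caseB hadj hinj h hh I J hI' hJ' hI hJ hA hB
    · push Not at hB
      exact caseC hG1 hadj hinj h hh I J hI' hJ' hI hJ hB
end

section
/- Let H be a 2-connected graph on n ≥ 7 vertices such that every vertex except possibly a specified vertex u₁ has degree at least 3, and let G be obtained from H by attaching a pendant path with 3 additional vertices at u₁ (identify u₁ with an endpoint of P_4). Then G contains both P_7 ∪ P_3 and P_5 ∪ P_5 as subgraphs. -/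
open SimpleGraph

section Helpers
variable {V : Type*} [DecidableEq V]

def NoPath0 (H : SimpleGraph V) (u : V) : Prop := ∀ a b c d e f : V, [u,a,b,c,d,e,f].Nodup →
  H.Adj u a → H.Adj a b → H.Adj b c → H.Adj c d → H.Adj d e → H.Adj e f → False
def NoPath1 (H : SimpleGraph V) (u : V) : Prop := ∀ z b c d e f : V, [z,u,b,c,d,e,f].Nodup →
  H.Adj z u → H.Adj u b → H.Adj b c → H.Adj c d → H.Adj d e → H.Adj e f → False
def NoPath6 (H : SimpleGraph V) (u : V) : Prop := ∀ a b c d e : V, [u,a,b,c,d,e].Nodup →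
  H.Adj u a → H.Adj a b → H.Adj b c → H.Adj c d → H.Adj d e → False
def NoPath5 (H : SimpleGraph V) (u : V) : Prop := ∀ a b c d : V, [u,a,b,c,d].Nodup →
  H.Adj u a → H.Adj a b → H.Adj b c → H.Adj c d → False
def DegF (H : SimpleGraph V) (u : V) : Prop :=
  ∀ v, v ≠ u → ∀ a b, ∃ y, H.Adj v y ∧ y ≠ a ∧ y ≠ b
def CutF (H : SimpleGraph V) : Prop :=
  ∀ (c : V) (S : Finset V), c ∉ S → S.Nonempty → (∃ b, b ∉ S ∧ b ≠ c) →
    ∃ a ∈ S, ∃ b, b ∉ S ∧ b ≠ c ∧ H.Adj a b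

variable {H : SimpleGraph V} {u : V}

lemma ext6 (h0 : NoPath0 H u) {a b c d e y : V} (hn : [u,a,b,c,d,e].Nodup)
    (h1 : H.Adj u a) (h2 : H.Adj a b) (h3 : H.Adj b c) (h4 : H.Adj c d) (h5 : H.Adj d e)
    (hy : H.Adj e y) : y ∈ [u,a,b,c,d] := by
  by_contra hc
  have := hy.ne
  exact h0 a b c d e y (by simp at *; grind) h1 h2 h3 h4 h5 hy

lemma ext5 (h0 : NoPath6 H u) {a b c d y : V} (hn : [u,a,b,c,d].Nodup)
    (h1 : H.Adj u a) (h2 : H.Adj a b) (h3 : H.Adj b c) (h4 : H.Adj c d)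
    (hy : H.Adj d y) : y ∈ [u,a,b,c] := by
  by_contra hc
  have := hy.ne
  exact h0 a b c d y (by simp at *; grind) h1 h2 h3 h4 hy

lemma ext4 (h0 : NoPath5 H u) {a b c y : V} (hn : [u,a,b,c].Nodup)
    (h1 : H.Adj u a) (h2 : H.Adj a b) (h3 : H.Adj b c)
    (hy : H.Adj c y) : y ∈ [u,a,b] := by
  by_contra hc
  have := hy.ne
  exact h0 a b c y (by simp at *; grind) h1 h2 h3 hy

set_option maxHeartbeats 4000000 in
lemma c6 (h0 : NoPath0 H u) (h1 : NoPath1 H u) (hD : DegF H u) (hC : CutF H)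
    (hcard : ∀ S : Finset V, S.card ≤ 6 → ∃ b, b ∉ S)
    {a b c d e : V} (hn : [u,a,b,c,d,e].Nodup)
    (e1 : H.Adj u a) (e2 : H.Adj a b) (e3 : H.Adj b c) (e4 : H.Adj c d) (e5 : H.Adj d e)
    (e6 : H.Adj e u) : False := by
  have key : ∀ w, w ∉ [u,a,b,c,d,e] → (∀ x ∈ [a,b,d,e], ¬ H.Adj x w) := by
    intro w hw x hx hxw
    simp only [List.mem_cons, List.not_mem_nil, or_false] at hx
    rcases hx with rfl | rfl | rfl | rfl
    · exact h0 e d c b x w (by simp at *; grind) e6.symm e5.symm e4.symm e3.symm e2.symm hxw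
    · exact h1 a e d c x w (by simp at *; grind) e1.symm e6.symm e5.symm e4.symm e3.symm hxw
    · exact h1 e a b c x w (by simp at *; grind) e6 e1 e2 e3 e4 hxw
    · exact h0 a b c d x w (by simp at *; grind) e1 e2 e3 e4 e5 hxw
  obtain ⟨w0, hw0⟩ := hcard {u,a,b,c,d,e} Finset.card_le_six
  obtain ⟨x, hx, w, hw, hwu, hxw⟩ := hC u {a,b,c,d,e} (by simp at *; grind) (by simp)
    ⟨w0, by simp at *; grind, by simp at *; grind⟩
  have hw' : w ∉ [u,a,b,c,d,e] := by simp at *; grind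
  have hk := key w hw'
  have hxc : x = c := by simp at *; grind
  subst hxc
  obtain ⟨y, hy, hyu, hyx⟩ := hD w hwu u x
  have hyn : y ∉ [u,a,b,x,d,e] := by
    intro hh
    have := hk y
    have := hy.symm
    simp at *; grind
  have := hy.ne
  exact h1 a e d x w y (by simp at *; grind) e1.symm e6.symm e5.symm e4.symm hxw hy

set_option maxHeartbeats 4000000 in
lemma t5 (h0 : NoPath0 H u) (h1 : NoPath1 H u) (hD : DegF H u) (hC : CutF H)
    (hcard : ∀ S : Finset V, S.card ≤ 6 → ∃ b, b ∉ S)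
    {a b c d e : V} (hn : [u,a,b,c,d,e].Nodup)
    (e1 : H.Adj u a) (e2 : H.Adj a b) (e3 : H.Adj b c) (e4 : H.Adj c d) (e5 : H.Adj d e)
    (e6 : H.Adj e a) : False := by
  -- a vertex `y` outside, adjacent to the vertex opposite of the attachment vertex
  have key : ∀ a b c d e : V, [u,a,b,c,d,e].Nodup → H.Adj u a → H.Adj a b → H.Adj b c →
      H.Adj c d → H.Adj d e → H.Adj e a → ∀ y, y ∉ [u,a,b,c,d,e] → ¬ H.Adj c y := by
    intro a b c d e hn e1 e2 e3 e4 e5 e6 y hy hcy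
    have hn' : [u,a,e,d,c,b].Nodup := by simp at *; grind
    have hE : ∀ z, H.Adj e z → z ∈ [u,a,b,c,d] := fun z hz => ext6 h0 hn e1 e2 e3 e4 e5 hz
    have hB : ∀ z, H.Adj b z → z ∈ [u,a,e,d,c] := fun z hz =>
      ext6 h0 hn' e1 e6.symm e5.symm e4.symm e3.symm hz
    have hn2 : [u,a,e,d,c,y].Nodup := by simp at *; grind
    have hY : ∀ z, H.Adj y z → z ∈ [u,a,e,d,c] := fun z hz =>
      ext6 h0 hn2 e1 e6.symm e5.symm e4.symm hcy hz
    have hYu : ¬ H.Adj y u := fun h =>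
      c6 h0 h1 hD hC hcard hn2 e1 e6.symm e5.symm e4.symm hcy h
    have hYd : ¬ H.Adj y d := fun h =>
      h0 a b c y d e (by simp at *; grind) e1 e2 e3 hcy h e5
    obtain ⟨z, hz, hza, hzc⟩ := hD y (by simp at *; grind) a c
    have hz1 := hY z hz
    have hz2 := hE y
    have hz3 := hz.symm
    simp at *; grind
  have hn' : [u,a,e,d,c,b].Nodup := by simp at *; grind
  have hE : ∀ z, H.Adj e z → z ∈ [u,a,b,c,d] := fun z hz => ext6 h0 hn e1 e2 e3 e4 e5 hz
  have hB : ∀ z, H.Adj b z → z ∈ [u,a,e,d,c] := fun z hz =>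
    ext6 h0 hn' e1 e6.symm e5.symm e4.symm e3.symm hz
  have hEu : ¬ H.Adj e u := fun h => c6 h0 h1 hD hC hcard hn e1 e2 e3 e4 e5 h
  have hBu : ¬ H.Adj b u := fun h => c6 h0 h1 hD hC hcard hn' e1 e6.symm e5.symm e4.symm e3.symm h
  have hCy : ∀ y, y ∉ [u,a,b,c,d,e] → ¬ H.Adj c y := key a b c d e hn e1 e2 e3 e4 e5 e6
  have hDy : ∀ y, y ∉ [u,a,b,c,d,e] → ¬ H.Adj d y := fun y hy =>
    key a e d c b hn' e1 e6.symm e5.symm e4.symm e3.symm e2.symm y (by simp at *; grind)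
  -- u adjacent to c or d
  obtain ⟨x, hx, w, hw, hwa, hxw⟩ := hC a {b,c,d,e} (by simp at *; grind) (by simp)
    ⟨u, by simp at *; grind, by simp at *; grind⟩
  have hux : w = u ∧ (x = c ∨ x = d) := by
    have := hE w; have := hB w; have := hCy w; have := hDy w
    simp at *; grind
  obtain ⟨w0, hw0⟩ := hcard {u,a,b,c,d,e} Finset.card_le_six
  obtain ⟨p, hp, q, hq, hqu, hpq⟩ := hC u {a,b,c,d,e} (by simp at *; grind) (by simp)
    ⟨w0, by simp at *; grind, by simp at *; grind⟩
  have hpa : p = a := by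
    have := hE q; have := hB q; have := hCy q; have := hDy q
    simp at *; grind
  subst hpa
  obtain ⟨rfl, rfl | rfl⟩ := hux
  · exact key x b p e d (by simp at *; grind) hxw.symm e3.symm e2.symm e6.symm e5.symm e4.symm
      q (by simp at *; grind) hpq
  · exact key x e p b c (by simp at *; grind) hxw.symm e5 e6 e2 e3 e4
      q (by simp at *; grind) hpq

set_option maxHeartbeats 4000000 in
lemma no6 (h0 : NoPath0 H u) (h1 : NoPath1 H u) (hD : DegF H u) (hC : CutF H)
    (hcard : ∀ S : Finset V, S.card ≤ 6 → ∃ b, b ∉ S) : NoPath6 H u := by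
  intro a b c d e hn e1 e2 e3 e4 e5
  have P : ∀ a b c d e : V, [u,a,b,c,d,e].Nodup → H.Adj u a → H.Adj a b → H.Adj b c →
      H.Adj c d → H.Adj d e → ∀ z, H.Adj e z → z ∈ [b,c,d] := by
    intro a b c d e hn e1 e2 e3 e4 e5 z hz
    have := ext6 h0 hn e1 e2 e3 e4 e5 hz
    have hu : z ≠ u := by rintro rfl; exact c6 h0 h1 hD hC hcard hn e1 e2 e3 e4 e5 hz
    have ha : z ≠ a := by rintro rfl; exact t5 h0 h1 hD hC hcard hn e1 e2 e3 e4 e5 hz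
    simp at *; grind
  have hE := P a b c d e hn e1 e2 e3 e4 e5
  have heu : e ≠ u := by simp at *; grind
  have eb : H.Adj e b := by
    obtain ⟨z, hz, _, _⟩ := hD e heu c d
    have := hE z hz
    simp at *; grind
  have ec : H.Adj e c := by
    obtain ⟨z, hz, _, _⟩ := hD e heu b d
    have := hE z hz
    simp at *; grind
  have hc := P a b e d c (by simp at *; grind) e1 e2 eb.symm e5.symm e4.symm
  have hd := P a b c e d (by simp at *; grind) e1 e2 e3 ec.symm e5.symm
  obtain ⟨x, hx, w, hw, hwa, hxw⟩ := hC b {c,d,e} (by simp at *; grind) (by simp)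
    ⟨u, by simp at *; grind, by simp at *; grind⟩
  have := hc w; have := hd w; have := hE w
  simp at *; grind

set_option maxHeartbeats 4000000 in
lemma no5 (h0 : NoPath6 H u) (hD : DegF H u) (hC : CutF H)
    (hcard : ∀ S : Finset V, S.card ≤ 6 → ∃ b, b ∉ S) : NoPath5 H u := by
  have cyc : ∀ a b c d : V, [u,a,b,c,d].Nodup → H.Adj u a → H.Adj a b → H.Adj b c →
      H.Adj c d → H.Adj d u → False := by
    intro a b c d hn e1 e2 e3 e4 e5
    have hn' : [u,d,c,b,a].Nodup := by simp at *; grind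
    have key : ∀ a b c d : V, [u,a,b,c,d].Nodup → H.Adj u a → H.Adj a b → H.Adj b c →
      H.Adj c d → H.Adj d u → ∀ w, w ∉ [u,a,b,c,d] → ¬ H.Adj b w := by
      intro a b c d hn e1 e2 e3 e4 e5 w hw hbw
      have hn' : [u,d,c,b,a].Nodup := by simp at *; grind
      have hW := fun z => ext5 h0 (y := z) (a := d) (b := c) (c := b) (d := w)
        (by simp at *; grind) e5.symm e4.symm e3.symm hbw
      obtain ⟨z, hz, _, _⟩ := hD w (by simp at *; grind) u b
      have hz1 := hW z hz
      have hd := ext5 h0 (y := w) hn e1 e2 e3 e4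
      have hcw : H.Adj c w := by
        have := hz.symm
        simp at *; grind
      exact h0 a b w c d (by simp at *; grind) e1 e2 hbw hcw.symm e4
    have hb := key a b c d hn e1 e2 e3 e4 e5
    have hc := key d c b a hn' e5.symm e4.symm e3.symm e2.symm e1.symm
    have hd := fun w => ext5 h0 (y := w) hn e1 e2 e3 e4
    have ha := fun w => ext5 h0 (y := w) hn' e5.symm e4.symm e3.symm e2.symm
    obtain ⟨w0, hw0⟩ := hcard {u,a,b,c,d} (Finset.card_le_five.trans (by norm_num))
    obtain ⟨p, hp, q, hq, hqu, hpq⟩ := hC u {a,b,c,d} (by simp at *; grind) (by simp)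
      ⟨w0, by simp at *; grind, by simp at *; grind⟩
    have := ha q; have := hb q; have := hc q; have := hd q
    simp at *; grind
  intro a b c d hn e1 e2 e3 e4
  have P : ∀ a b c d : V, [u,a,b,c,d].Nodup → H.Adj u a → H.Adj a b → H.Adj b c →
      H.Adj c d → ∀ z, H.Adj d z → z ∈ [a,b,c] := by
    intro a b c d hn e1 e2 e3 e4 z hz
    have := ext5 h0 hn e1 e2 e3 e4 hz
    have hu : z ≠ u := by rintro rfl; exact cyc _ _ _ _ hn e1 e2 e3 e4 hz
    simp at *; grind
  have hE := P a b c d hn e1 e2 e3 e4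
  have heu : d ≠ u := by simp at *; grind
  have ea : H.Adj d a := by
    obtain ⟨z, hz, _, _⟩ := hD d heu b c
    have := hE z hz
    simp at *; grind
  have eb : H.Adj d b := by
    obtain ⟨z, hz, _, _⟩ := hD d heu a c
    have := hE z hz
    simp at *; grind
  have hb := P a d c b (by simp at *; grind) e1 ea.symm e4.symm e3.symm
  have hc := P a b d c (by simp at *; grind) e1 e2 eb.symm e4.symm
  obtain ⟨x, hx, w, hw, hwa, hxw⟩ := hC a {b,c,d} (by simp at *; grind) (by simp)
    ⟨u, by simp at *; grind, by simp at *; grind⟩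
  have := hb w; have := hc w; have := hE w
  simp at *; grind

set_option maxHeartbeats 4000000 in
lemma no4 (h0 : NoPath5 H u) (hD : DegF H u) (hC : CutF H)
    (hcard : ∀ S : Finset V, S.card ≤ 6 → ∃ b, b ∉ S) 
    {a b c : V} (hn : [u,a,b,c].Nodup) (e1 : H.Adj u a) (e2 : H.Adj a b) (e3 : H.Adj b c) :
    False := by
  have hE := fun z => ext4 h0 (y := z) hn e1 e2 e3
  have heu : c ≠ u := by simp at *; grind
  have e4 : H.Adj c u := by
    obtain ⟨z, hz, _, _⟩ := hD c heu a b
    have := hE z hz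
    simp at *; grind
  have hA := fun z => ext4 h0 (y := z) (a := c) (b := b) (c := a)
    (by simp at *; grind) e4.symm e3.symm e2.symm
  obtain ⟨w0, hw0⟩ := hcard {u,a,b,c} (Finset.card_le_four.trans (by norm_num))
  obtain ⟨p, hp, q, hq, hqu, hpq⟩ := hC u {a,b,c} (by simp at *; grind) (by simp)
    ⟨w0, by simp at *; grind, by simp at *; grind⟩
  have hpb : p = b := by
    have := hA q; have := hE q
    simp at *; grind
  subst hpb
  obtain ⟨z, hz, hzu, hzp⟩ := hD q hqu u p
  have := ext4 h0 (y := z) (a := a) (b := p) (c := q) (by simp at *; grind) e1 e2 hpq hz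
  have := hA q
  have := hz.symm
  simp at *; grind

lemma main_path (hD : DegF H u) (hC : CutF H)
    (hcard : ∀ S : Finset V, S.card ≤ 6 → ∃ b, b ∉ S) : ¬ (NoPath0 H u ∧ NoPath1 H u) := by
  rintro ⟨h0, h1⟩
  have h5 := no5 (no6 h0 h1 hD hC hcard) hD hC hcard
  obtain ⟨w, hw⟩ := hcard {u} (by simp)
  obtain ⟨w', hw'⟩ := hcard {u, w} (Finset.card_le_two.trans (by norm_num))
  obtain ⟨p, hp, a, ha, _, e1⟩ := hC w {u} (by simp at *; grind) (by simp)
    ⟨w', by simp at *; grind, by simp at *; grind⟩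
  have : p = u := by simpa using hp
  subst this
  have hau : a ≠ p := by simpa using ha
  obtain ⟨b, e2, hb, _⟩ := hD a hau p p
  obtain ⟨c, e3, hc, hca⟩ := hD b hb p a
  have := e2.ne; have := e3.ne
  exact no4 h5 hD hC hcard (a := a) (b := b) (c := c) (by simp at *; grind) e1 e2 e3

end Helpers

lemma forest_of {W : Type*} (G : SimpleGraph W) (m n : ℕ) (f : Fin m → W) (g : Fin n → W)
    (hf : Function.Injective f) (hg : Function.Injective g) (hfg : ∀ a b, f a ≠ g b)
    (hf' : ∀ (a : ℕ) (ha : a + 1 < m), G.Adj (f ⟨a, by omega⟩) (f ⟨a + 1, ha⟩))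
    (hg' : ∀ (a : ℕ) (ha : a + 1 < n), G.Adj (g ⟨a, by omega⟩) (g ⟨a + 1, ha⟩)) :
    ContainsForest G ![m, n] := by
  refine ⟨fun i => match i with | 0 => f | 1 => g, ?_, ?_, ?_⟩
  · intro i; fin_cases i
    · exact hf
    · exact hg
  · intro i j hij; fin_cases i <;> fin_cases j
    · simp at hij
    · exact hfg
    · exact fun a b h => hfg b a h.symm
    · simp at hij
  · intro i; fin_cases i
    · exact hf'
    · exact hg'

lemma forest_list {W : Type*} (G : SimpleGraph W) (l k : List W) (h : (l ++ k).Nodup)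
    (hl : l.IsChain G.Adj) (hk : k.IsChain G.Adj) : ContainsForest G ![l.length, k.length] := by
  rw [List.nodup_append] at h
  refine forest_of G _ _ l.get k.get (List.nodup_iff_injective_get.1 h.1)
    (List.nodup_iff_injective_get.1 h.2.1) (fun a b => h.2.2 _ (l.get_mem a) _ (k.get_mem b)) ?_ ?_
  · intro a ha; exact List.isChain_iff_getElem.1 hl a ha
  · intro a ha; exact List.isChain_iff_getElem.1 hk a ha

set_option maxHeartbeats 2000000 in
theorem stmt_11 {V : Type*} [Fintype V] [DecidableEq V] (H : SimpleGraph V)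
    [DecidableRel H.Adj] (hH : TwoConnected H) (hcard : 7 ≤ Fintype.card V)
    (u₁ : V) (hd : ∀ v, v ≠ u₁ → 3 ≤ H.degree v) :
    ContainsForest (attachPath H u₁ 3) ![7, 3] ∧
    ContainsForest (attachPath H u₁ 3) ![5, 5] := by
  have hD : DegF H u₁ := by
    intro v hv a b
    have h3 := hd v hv
    have : ∃ y ∈ H.neighborFinset v, y ∉ ({a, b} : Finset V) := by
      apply Finset.exists_mem_notMem_of_card_lt_card
      rw [SimpleGraph.card_neighborFinset_eq_degree]
      exact lt_of_le_of_lt Finset.card_le_two (by omega)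
    obtain ⟨y, hy, hy'⟩ := this
    refine ⟨y, by simpa using hy, ?_⟩
    simpa using hy'
  have hC : CutF H := by
    rintro c S hcS ⟨a, ha⟩ ⟨b, hbS, hbc⟩
    have hconn := hH.2 {c} (by simp)
    have hac : a ≠ c := fun h => hcS (h ▸ ha)
    obtain ⟨p⟩ := hconn.preconnected ⟨a, by simpa using hac⟩ ⟨b, by simpa using hbc⟩
    obtain ⟨d, -, h1, h2⟩ := p.exists_boundary_dart {x | x.1 ∈ S} ha hbS
    refine ⟨d.fst.1, h1, d.snd.1, h2, ?_, d.adj⟩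
    have := d.snd.2
    simpa using this
  have hK : ∀ S : Finset V, S.card ≤ 6 → ∃ b, b ∉ S := by
    intro S hS
    by_contra! h
    have : S = Finset.univ := Finset.eq_univ_iff_forall.2 h
    rw [this, Finset.card_univ] at hS
    omega
  have hadj : ∀ x y, H.Adj x y → (attachPath H u₁ 3).Adj (Sum.inl x) (Sum.inl y) := by
    intro x y h
    refine ⟨by simpa using h.ne, Or.inl (Or.inl ⟨x, y, rfl, rfl, h⟩)⟩
  have hu : (attachPath H u₁ 3).Adj (Sum.inr 0) (Sum.inl u₁) := by
    refine ⟨by simp, Or.inr (Or.inr (Or.inl ⟨0, rfl, rfl, rfl⟩))⟩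
  have h10 : (attachPath H u₁ 3).Adj (Sum.inr 1) (Sum.inr 0) := by
    refine ⟨by simp, Or.inr (Or.inr (Or.inr ⟨0, 1, rfl, rfl, rfl⟩))⟩
  have h21 : (attachPath H u₁ 3).Adj (Sum.inr 2) (Sum.inr 1) := by
    refine ⟨by simp, Or.inr (Or.inr (Or.inr ⟨1, 2, rfl, rfl, rfl⟩))⟩
  by_contra hno
  refine main_path hD hC hK ⟨?_, ?_⟩
  · intro a b c d e f hn e1 e2 e3 e4 e5 e6
    apply hno
    constructor
    · refine forest_list _ [Sum.inl u₁, Sum.inl a, Sum.inl b, Sum.inl c, Sum.inl d, Sum.inl e,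
        Sum.inl f] [Sum.inr 2, Sum.inr 1, Sum.inr 0] ?_ ?_ ?_
      · simp at *; grind
      · simp [*]
      · simp [*]
    · refine forest_list _ [Sum.inr 2, Sum.inr 1, Sum.inr 0, Sum.inl u₁, Sum.inl a]
        [Sum.inl b, Sum.inl c, Sum.inl d, Sum.inl e, Sum.inl f] ?_ ?_ ?_
      · simp at *; grind
      · simp [*]
      · simp [*]
  · intro a b c d e f hn e1 e2 e3 e4 e5 e6
    apply hno
    have e1' := e1.symm
    constructor
    · refine forest_list _ [Sum.inl a, Sum.inl u₁, Sum.inl b, Sum.inl c, Sum.inl d, Sum.inl e,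
        Sum.inl f] [Sum.inr 2, Sum.inr 1, Sum.inr 0] ?_ ?_ ?_
      · simp at *; grind
      · simp [*]
      · simp [*]
    · refine forest_list _ [Sum.inr 2, Sum.inr 1, Sum.inr 0, Sum.inl u₁, Sum.inl a]
        [Sum.inl b, Sum.inl c, Sum.inl d, Sum.inl e, Sum.inl f] ?_ ?_ ?_
      · simp at *; grind
      · simp [*]
      · simp [*]
end

section
/- Let G be a connected graph on n ≥ 2h+2 vertices with minimum degree δ(G) ≥ h ≥ 1, and let a₁ ≥ ... ≥ a_k ≥ 1 with k ≥ 2 and Σᵢaᵢ = h+1. Then G contains the disjoint union ⋃ᵢP_{2aᵢ} as a subgraph, unless G ⊆ S_{n,h} = K_h ∨ complement(K_{n-h}), or k = 2, a₁ = a₂, and G = L_{t,h} = K_1 ∨ tK_h with n = th+1. -/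
open SimpleGraph

set_option linter.unusedSectionVars false
set_option linter.unusedVariables false

namespace S15

def PP {V : Type*} (G : SimpleGraph V) (p : ℕ → V) (m : ℕ) : Prop :=
  (∀ i j, i < m → j < m → p i = p j → i = j) ∧ ∀ i, i + 1 < m → G.Adj (p i) (p (i + 1))

def CC {V : Type*} (G : SimpleGraph V) (p : ℕ → V) (m : ℕ) : Prop :=
  (∀ i j, p i = p j ↔ i % m = j % m) ∧ ∀ i, G.Adj (p i) (p (i + 1))

def cons {V : Type*} (w : V) (p : ℕ → V) : ℕ → V := fun j => if j = 0 then w else p (j - 1)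

variable {V : Type*} {G : SimpleGraph V}

theorem PP.mono {p : ℕ → V} {m m' : ℕ} (hp : PP G p m) (h : m' ≤ m) : PP G p m' :=
  ⟨fun i j hi hj => hp.1 i j (by omega) (by omega), fun i hi => hp.2 i (by omega)⟩

theorem PP.cons {p : ℕ → V} {m : ℕ} (hp : PP G p m) {w : V} (hw : ∀ i < m, p i ≠ w)
    (ha : G.Adj w (p 0)) : PP G (cons w p) (m + 1) := by
  refine ⟨?_, ?_⟩
  · intro i j hi hj h
    unfold S15.cons at h
    split_ifs at h with h1 h2 h2
    · omega
    · exact absurd h.symm (hw _ (by omega))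
    · exact absurd h (hw _ (by omega))
    · have := hp.1 _ _ (by omega) (by omega) h
      omega
  · intro i hi
    unfold S15.cons
    by_cases h : i = 0
    · subst h; simpa using ha
    · have := hp.2 (i - 1) (by omega)
      rw [show i - 1 + 1 = i by omega] at this
      simpa [h] using this

theorem PP.comp {p : ℕ → V} {m m' : ℕ} (hp : PP G p m) (s : ℕ → ℕ) (h1 : ∀ i < m', s i < m)
    (h2 : ∀ i j, i < m' → j < m' → s i = s j → i = j)
    (h3 : ∀ i, i + 1 < m' → s i + 1 = s (i + 1) ∨ s (i + 1) + 1 = s i ∨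
      G.Adj (p (s i)) (p (s (i + 1)))) : PP G (fun i => p (s i)) m' := by
  refine ⟨fun i j hi hj h => h2 i j hi hj (hp.1 _ _ (h1 i hi) (h1 j hj) h), fun i hi => ?_⟩
  have a1 := h1 i (by omega)
  have a2 := h1 (i + 1) hi
  rcases h3 i hi with h | h | h
  · have := hp.2 (s i) (by omega)
    rwa [h] at this
  · have := hp.2 (s (i + 1)) (by omega)
    rw [h] at this
    exact this.symm
  · exact h

theorem PP.rev {p : ℕ → V} {m : ℕ} (hp : PP G p m) : PP G (fun i => p (m - 1 - i)) m :=
  hp.comp _ (fun i hi => by omega) (fun i j hi hj h => by omega) (fun i hi => by omega)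

theorem PP.cc {p : ℕ → V} {m : ℕ} (hp : PP G p m) (hm : 1 ≤ m) (h : G.Adj (p (m - 1)) (p 0)) :
    CC G (fun i => p (i % m)) m := by
  refine ⟨fun i j => ⟨fun h => hp.1 _ _ (Nat.mod_lt _ hm) (Nat.mod_lt _ hm) h,
    fun h => by simp [h]⟩, fun i => ?_⟩
  have h1 := Nat.mod_lt i hm
  simp only
  by_cases hi : i % m + 1 < m
  · rw [Nat.add_mod_eq_add_mod_right 1 (Nat.mod_mod i m).symm, Nat.mod_eq_of_lt hi]
    exact hp.2 _ hi
  · have : i % m = m - 1 := by omega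
    rw [Nat.add_mod_eq_add_mod_right 1 (Nat.mod_mod i m).symm, this,
      show m - 1 + 1 = m by omega, Nat.mod_self]
    exact h

theorem mod_inj_aux {a i j m : ℕ} (hi : i < m) (hj : j < m) (h : (a + i) % m = (a + j) % m) :
    i = j := by
  have : i ≡ j [MOD m] := Nat.ModEq.add_left_cancel' a h
  exact Nat.ModEq.eq_of_lt_of_lt this hi hj

theorem CC.pp {p : ℕ → V} {m : ℕ} (hp : CC G p m) (a : ℕ) : PP G (fun i => p (a + i)) m :=
  ⟨fun i j hi hj h => mod_inj_aux hi hj ((hp.1 _ _).1 h), fun i _ => hp.2 (a + i)⟩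

theorem boundary (hc : G.Connected) (S : V → Prop) {x y : V} (hx : S x) (hy : ¬ S y) :
    ∃ u w, S u ∧ ¬ S w ∧ G.Adj u w := by
  obtain ⟨W⟩ := hc.preconnected x y
  obtain ⟨d, -, h1, h2⟩ := W.exists_boundary_dart {v | S v} hx hy
  exact ⟨d.fst, d.snd, h1, h2, d.adj⟩

variable [Fintype V]

theorem exists_outside (p : ℕ → V) {m : ℕ} (h : m < Fintype.card V) : ∃ w, ∀ i < m, p i ≠ w := by
  classical
  by_contra! hcon
  have : (Finset.univ : Finset V) ⊆ (Finset.range m).image p := by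
    intro w _
    obtain ⟨i, hi, rfl⟩ := hcon w
    exact Finset.mem_image_of_mem _ (Finset.mem_range.2 hi)
  have h1 := Finset.card_le_card this
  have h2 := Finset.card_image_le (s := Finset.range m) (f := p)
  simp at h1 h2
  omega

theorem CC.per {p : ℕ → V} {m : ℕ} (hp : CC G p m) (i : ℕ) : p (i % m) = p i :=
  (hp.1 _ _).2 (Nat.mod_mod _ _)

theorem CC.ne {p : ℕ → V} {m : ℕ} (hm : 1 ≤ m) (hp : CC G p m) {w : V} (hw : ∀ i < m, p i ≠ w)
    (i : ℕ) : p i ≠ w := by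
  rw [← hp.per]; exact hw _ (Nat.mod_lt _ hm)

theorem CC.ext {p : ℕ → V} {m : ℕ} (hm : 1 ≤ m) (hc : G.Connected) (hp : CC G p m)
    (h : m < Fintype.card V) : ∃ q, PP G q (m + 1) := by
  obtain ⟨w, hw⟩ := exists_outside p h
  obtain ⟨u, x, ⟨i, rfl⟩, hx, hux⟩ := boundary hc (fun v => ∃ i, p i = v) (x := p 0) (y := w)
    ⟨0, rfl⟩ (by rintro ⟨i, hi⟩; exact hp.ne hm hw i hi)
  push Not at hx
  exact ⟨_, (hp.pp i).cons (w := x) (fun j _ => hx _) hux.symm⟩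

/-- crossing argument -/
theorem nocross {p : ℕ → V} {m : ℕ} (hc : G.Connected) (hp : PP G p m)
    (h : m < Fintype.card V) (hmax : ∀ q, ¬ PP G q (m + 1)) {i : ℕ} (hi : i + 1 < m)
    (h1 : G.Adj (p 0) (p (i + 1))) (h2 : G.Adj (p (m - 1)) (p i)) : False := by
  have hq : PP G (fun j => p (if j ≤ i then j else m + i - j)) m := by
    refine hp.comp _ (fun j hj => by split_ifs <;> omega)
      (fun j l hj hl h => by split_ifs at h <;> omega) (fun j hj => ?_)
    by_cases hji : j = i
    · subst hji
      right; right
      simp only [le_refl, if_true, show ¬ j + 1 ≤ j by omega, if_false]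
      rw [show m + j - (j + 1) = m - 1 by omega]
      exact h2.symm
    · split_ifs <;> omega
  have hcc := hq.cc (by omega) (by
    simp only [show ¬ m - 1 ≤ i by omega, if_false, Nat.zero_le, if_true]
    rw [show m + i - (m - 1) = i + 1 by omega]
    exact h1.symm)
  obtain ⟨q, hq⟩ := hcc.ext (by omega) hc h
  exact hmax q hq

theorem nbr_in {p : ℕ → V} {m : ℕ} (hp : PP G p m) (hmax : ∀ q, ¬ PP G q (m + 1)) {x : V}
    (hx : G.Adj (p 0) x) : ∃ i, i < m ∧ p i = x := by
  by_contra! hcon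
  exact hmax _ (hp.cons (w := x) hcon hx.symm)

variable [DecidableEq V] [DecidableRel G.Adj]

theorem deg_le {p : ℕ → V} {m : ℕ} (hp : PP G p m) (hmax : ∀ q, ¬ PP G q (m + 1)) :
    G.degree (p 0) ≤ ((Finset.range (m - 1)).filter (fun i => G.Adj (p 0) (p (i + 1)))).card := by
  rw [← G.card_neighborFinset_eq_degree]
  refine le_trans (Finset.card_le_card (t := ((Finset.range (m - 1)).filter
    (fun i => G.Adj (p 0) (p (i + 1)))).image (fun i => p (i + 1))) ?_) Finset.card_image_le
  intro x hx
  rw [SimpleGraph.mem_neighborFinset] at hx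
  obtain ⟨i, hi, rfl⟩ := nbr_in hp hmax hx
  have : i ≠ 0 := by rintro rfl; exact G.loopless.irrefl _ hx
  refine Finset.mem_image.2 ⟨i - 1, ?_, by simp only [show i - 1 + 1 = i by omega]⟩
  simp only [Finset.mem_filter, Finset.mem_range, show i - 1 + 1 = i by omega]
  exact ⟨by omega, hx⟩

theorem counts {p : ℕ → V} {m h : ℕ} (hδ : ∀ v, h ≤ G.degree v) (hc : G.Connected)
    (hp : PP G p m) (hm : 1 ≤ m)
    (hn : m < Fintype.card V) (hmax : ∀ q, ¬ PP G q (m + 1)) :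
    2 * h + 1 ≤ m ∧ (m = 2 * h + 1 →
      ((Finset.range (2 * h)).filter (fun i => G.Adj (p 0) (p (i + 1)))).card = h ∧
      ∀ i < 2 * h, G.Adj (p 0) (p (i + 1)) ∨ G.Adj (p (2 * h)) (p i)) := by
  set A := (Finset.range (m - 1)).filter (fun i => G.Adj (p 0) (p (i + 1))) with hA
  set B := (Finset.range (m - 1)).filter (fun i => G.Adj (p (m - 1)) (p i)) with hB
  have cA : h ≤ A.card := (hδ _).trans (deg_le hp hmax)
  have cB : h ≤ B.card := by
    have h1 := (hδ _).trans (deg_le hp.rev hmax)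
    refine h1.trans ?_
    refine Finset.card_le_card_of_injOn (fun i => m - 1 - (i + 1)) ?_ ?_
    · intro i hi
      simp only [Finset.coe_filter, Finset.mem_range, Set.mem_ofPred_eq, hB, Nat.sub_zero] at hi ⊢
      exact ⟨by omega, hi.2⟩
    · intro i hi j hj hij
      simp only [Finset.coe_filter, Finset.mem_range, Set.mem_ofPred_eq] at hi hj hij
      omega
  have hd : Disjoint A B := by
    rw [Finset.disjoint_left]
    intro i hi hi'
    simp only [hA, hB, Finset.mem_filter, Finset.mem_range] at hi hi'
    exact nocross hc hp hn hmax (by omega) hi.2 hi'.2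
  have hsub : A ∪ B ⊆ Finset.range (m - 1) :=
    Finset.union_subset (Finset.filter_subset _ _) (Finset.filter_subset _ _)
  have hcu := Finset.card_union_of_disjoint hd
  have hcs := Finset.card_le_card hsub
  rw [Finset.card_range] at hcs
  refine ⟨by omega, ?_⟩
  rintro rfl
  have heq : A ∪ B = Finset.range (2 * h + 1 - 1) :=
    Finset.eq_of_subset_of_card_le hsub (by simp; omega)
  refine ⟨?_, ?_⟩
  · have : A.card = h := by omega
    exact this
  · intro i hi
    have : i ∈ A ∪ B := by rw [heq]; simpa using hi
    simp only [hA, hB, Finset.mem_union, Finset.mem_filter, Finset.mem_range] at this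
    rcases this with h | h
    · exact Or.inl h.2
    · exact Or.inr h.2

theorem exists_path {h : ℕ} (hδ : ∀ v, h ≤ G.degree v) (hc : G.Connected)
    (hn : 2 * h + 2 ≤ Fintype.card V) : ∀ m, m ≤ 2 * h + 1 → ∃ p, PP G p m := by
  intro m
  induction m with
  | zero =>
    intro _
    obtain ⟨v⟩ := hc.nonempty
    exact ⟨fun _ => v, fun i j hi => by omega, fun i hi => by omega⟩
  | succ m ih =>
    intro hm
    obtain ⟨p, hp⟩ := ih (by omega)
    by_cases hm0 : m = 0
    · subst hm0
      exact ⟨p, fun i j hi hj _ => by omega, fun i hi => by omega⟩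
    by_contra! hcon
    have := (counts hδ hc hp (by omega) (by omega) hcon).1
    omega

/-! cycle case -/

theorem cyc_indep {h : ℕ} (hh : 1 ≤ h) (hc : G.Connected) (hmax : ∀ q, ¬ PP G q (2 * h + 2))
    {p : ℕ → V} (hp : CC G p (2 * h)) {x y : V} (hx : ∀ i, p i ≠ x) (hy : ∀ i, p i ≠ y) :
    ¬ G.Adj x y := by
  intro hxy
  obtain ⟨u, w, ⟨hu, u', hu', huu'⟩, hw, huw⟩ := boundary hc
    (fun v => (∀ i, p i ≠ v) ∧ ∃ v', (∀ i, p i ≠ v') ∧ G.Adj v v') (x := x) (y := p 0)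
    ⟨hx, y, hy, hxy⟩ (by rintro ⟨h, -⟩; exact h 0 rfl)
  have : ∃ i, p i = w := by
    by_contra! hcon
    exact hw ⟨hcon, u, hu, huw.symm⟩
  obtain ⟨i, rfl⟩ := this
  refine hmax _ (((hp.pp i).cons (w := u) (fun j _ => hu _) huw).cons (w := u') ?_ ?_)
  · intro j _
    unfold cons
    split_ifs
    · exact huu'.ne
    · exact hu' _
  · exact huu'.symm

theorem cyc_nocons {h : ℕ} (hh : 1 ≤ h) (hc : G.Connected) (hmax : ∀ q, ¬ PP G q (2 * h + 2))
    (hn : 2 * h + 2 ≤ Fintype.card V)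
    {p : ℕ → V} (hp : CC G p (2 * h)) {x : V} (hx : ∀ i, p i ≠ x) (i : ℕ)
    (h1 : G.Adj x (p i)) (h2 : G.Adj x (p (i + 1))) : False := by
  have hq := (hp.pp (i + 1)).cons (w := x) (fun j _ => hx _) h2
  have hcc := hq.cc (by omega) (by
    unfold cons
    simp only [show ¬ 2 * h + 1 - 1 = 0 by omega, if_false, if_true]
    have : p (i + 1 + (2 * h + 1 - 1 - 1)) = p i := by
      rw [hp.1, show i + 1 + (2 * h + 1 - 1 - 1) = i + 2 * h by omega, Nat.add_mod_right]
    rw [this]; exact h1.symm)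
  obtain ⟨q, hq⟩ := hcc.ext (by omega) hc (by omega)
  exact hmax q hq

theorem cyc_alt {h : ℕ} (hh : 1 ≤ h) (hδ : ∀ v, h ≤ G.degree v) (hc : G.Connected)
    (hmax : ∀ q, ¬ PP G q (2 * h + 2))
    (hn : 2 * h + 2 ≤ Fintype.card V)
    {p : ℕ → V} (hp : CC G p (2 * h)) {x : V} (hx : ∀ i, p i ≠ x) :
    G.degree x ≤ h ∧ ∀ i, G.Adj x (p i) ↔ ¬ G.Adj x (p (i + 1)) := by
  have key : ∀ a, G.degree x ≤
      ((Finset.range (2 * h)).filter (fun i => G.Adj x (p (a + i)))).card := by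
    intro a
    rw [← G.card_neighborFinset_eq_degree]
    refine le_trans (Finset.card_le_card (t := ((Finset.range (2 * h)).filter
      (fun i => G.Adj x (p (a + i)))).image (fun i => p (a + i))) ?_) Finset.card_image_le
    intro y hy
    rw [SimpleGraph.mem_neighborFinset] at hy
    have : ∃ i, p i = y := by
      by_contra! hcon
      exact cyc_indep hh hc hmax hp hx hcon hy
    obtain ⟨i, rfl⟩ := this
    have e : p (a + (i + (2 * h - a % (2 * h))) % (2 * h)) = p i := by
      rw [hp.1]
      have l := Nat.mod_lt a (show 0 < 2 * h by omega)
      have d := Nat.div_add_mod a (2 * h)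
      rw [Nat.add_mod, Nat.mod_mod, ← Nat.add_mod]
      have : a + (i + (2 * h - a % (2 * h))) = i + 2 * h * (a / (2 * h) + 1) := by
        rw [mul_add, mul_one]; omega
      rw [this, Nat.add_mul_mod_self_left]
    refine Finset.mem_image.2 ⟨(i + (2 * h - a % (2 * h))) % (2 * h), ?_, e⟩
    rw [Finset.mem_filter, Finset.mem_range, e]
    exact ⟨Nat.mod_lt _ (by omega), hy⟩
  set A := fun a => (Finset.range (2 * h)).filter (fun i => G.Adj x (p (a + i))) with hA
  have hd : ∀ a, Disjoint (A a) (A (a + 1)) := by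
    intro a
    rw [Finset.disjoint_left]
    intro i hi hi'
    simp only [hA, Finset.mem_filter] at hi hi'
    refine cyc_nocons hh hc hmax hn hp hx (a + i) hi.2 ?_
    rw [show a + i + 1 = a + 1 + i by omega]; exact hi'.2
  have hsub : ∀ a, A a ∪ A (a + 1) ⊆ Finset.range (2 * h) := fun a =>
    Finset.union_subset (Finset.filter_subset _ _) (Finset.filter_subset _ _)
  have hcu := fun a => Finset.card_union_of_disjoint (hd a)
  have hcs := fun a => Finset.card_le_card (hsub a)
  simp only [Finset.card_range] at hcs
  refine ⟨by have := hcu 0; have := hcs 0; have := key 0; have := key (0 + 1); simp only [hA] at *; omega, ?_⟩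
  intro i
  refine ⟨fun h1 h2 => cyc_nocons hh hc hmax hn hp hx i h1 h2, fun h2 => ?_⟩
  have heq : A i ∪ A (i + 1) = Finset.range (2 * h) :=
    Finset.eq_of_subset_of_card_le (hsub i) (by
      have := hcu i; have := hcs i; have := key i; have := key (i + 1); have := hδ x
      simp only [hA] at *; simp; omega)
  have : 0 ∈ A i ∪ A (i + 1) := by rw [heq]; simp; omega
  simp only [hA, Finset.mem_union, Finset.mem_filter, add_zero] at this
  tauto

theorem cyc_same {h : ℕ} (hh : 1 ≤ h) (hδ : ∀ v, h ≤ G.degree v) (hc : G.Connected)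
    (hmax : ∀ q, ¬ PP G q (2 * h + 2))
    (hn : 2 * h + 2 ≤ Fintype.card V)
    {p : ℕ → V} (hp : CC G p (2 * h)) {x y : V} (hx : ∀ i, p i ≠ x) (hy : ∀ i, p i ≠ y) (z : V)
    (hz : G.Adj x z) : G.Adj y z := by
  by_cases hxy : x = y
  · rwa [← hxy]
  have : ∃ i, p i = z := by
    by_contra! hcon
    exact cyc_indep hh hc hmax hp hx hcon hz
  obtain ⟨i, rfl⟩ := this
  by_contra hyi
  have h2 : G.Adj y (p (i + 1)) := by
    have := ((cyc_alt hh hδ hc hmax hn hp hy).2 i)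
    tauto
  have hq := ((hp.pp (i + 1)).cons (w := y) (fun j _ => hy _) h2).rev.cons (w := x) (by
    intro j _
    unfold cons
    split_ifs
    · exact fun h => hxy h.symm
    · exact hx _) (by
    unfold cons
    simp only [show ¬ 2 * h + 1 - 1 - 0 = 0 by omega, if_false]
    have : p (i + 1 + (2 * h + 1 - 1 - 0 - 1)) = p i := by
      rw [hp.1, show i + 1 + (2 * h + 1 - 1 - 0 - 1) = i + 2 * h by omega, Nat.add_mod_right]
    rw [this]; exact hz)
  exact hmax _ hq

theorem cyc_final {h : ℕ} (hh : 2 ≤ h) (hδ : ∀ v, h ≤ G.degree v) (hc : G.Connected)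
    (hmax : ∀ q, ¬ PP G q (2 * h + 2))
    (hn : 2 * h + 2 ≤ Fintype.card V)
    {p : ℕ → V} (hp : CC G p (2 * h)) :
    ∃ A : Finset V, A.card = h ∧ ∀ u v, G.Adj u v → u ∈ A ∨ v ∈ A := by
  obtain ⟨w0, hw0⟩ := exists_outside p (m := 2 * h) (by omega)
  obtain ⟨w1, hw1'⟩ := exists_outside (cons w0 p) (m := 2 * h + 1) (by omega)
  have hw1 : ∀ i < 2 * h, p i ≠ w1 := by
    intro i hi
    have := hw1' (i + 1) (by omega)
    simpa [cons] using this
  have h01 : w0 ≠ w1 := by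
    have := hw1' 0 (by omega)
    simpa [cons] using this
  replace hw0 := hp.ne (by omega) hw0
  replace hw1 := hp.ne (by omega) hw1
  have alt := cyc_alt (by omega) hδ hc hmax hn hp hw0
  refine ⟨G.neighborFinset w0, ?_, ?_⟩
  · rw [G.card_neighborFinset_eq_degree]; exact le_antisymm alt.1 (hδ _)
  intro u v huv
  simp only [SimpleGraph.mem_neighborFinset]
  by_contra! hcon
  obtain ⟨hu, hv⟩ := hcon
  by_cases huC : ∀ i, p i ≠ u
  · exact hv (cyc_same (by omega) hδ hc hmax hn hp huC hw0 v huv)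
  push Not at huC
  obtain ⟨b, rfl⟩ := huC
  have m1 : 1 % (2 * h) = 1 := Nat.mod_eq_of_lt (by omega)
  have e1 : ∀ i, p i = p b → G.Adj w0 (p (i + 1)) := by
    intro i hi
    have := alt.2 i
    rw [hi] at this; tauto
  have e2 : ∀ i, p (i + 1) = p b → G.Adj w0 (p i) := by
    intro i hi
    have := alt.2 i
    rw [hi] at this; tauto
  have hnn : ∀ i, p i ≠ p (i + 1) := fun i => (hp.2 i).ne
  classical
  have hq : CC G (fun i => if p i = p b then w0 else p i) (2 * h) := by
    refine ⟨fun i j => ?_, fun i => ?_⟩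
    · rw [← hp.1]
      simp only
      split_ifs with h1 h2 h2
      · simp [h1, h2]
      · constructor
        · intro h; exact absurd h.symm (hw0 _)
        · intro h; rw [← h] at h2; exact absurd h1 h2
      · constructor
        · intro h; exact absurd h (hw0 _)
        · intro h; rw [h] at h1; exact absurd h2 h1
      · rfl
    · simp only
      split_ifs with h1 h2 h2
      · exact absurd (h1.trans h2.symm) (hnn i)
      · exact e1 i h1
      · exact (e2 i h2).symm
      · exact hp.2 i
  have hu' : ∀ i, (if p i = p b then w0 else p i) ≠ p b := by
    intro i
    split_ifs with h1
    · exact (hw0 b).symm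
    · exact h1
  have hw1q : ∀ i, (if p i = p b then w0 else p i) ≠ w1 := by
    intro i
    split_ifs with h1
    · exact h01
    · exact hw1 i
  exact hv (cyc_same (by omega) hδ hc hmax hn hp hw1 hw0 v
    (cyc_same (by omega) hδ hc hmax hn hq hu' hw1q v huv))

theorem sub_S {h : ℕ} (A : Finset V) (hA : A.card = h) (hG : ∀ u v, G.Adj u v → u ∈ A ∨ v ∈ A) :
    SubgraphOf G (Sgraph (Fintype.card V) h) := by
  have hle : h ≤ Fintype.card V := hA ▸ Finset.card_le_univ A
  let e0 : V ≃ Fin (Fintype.card V) := Fintype.equivFin V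
  have e1 : {x // x ∈ A} ≃ {x : V // (e0 x).val < h} := by
    refine Equiv.trans ?_ (e0.subtypeEquiv (p := fun x => (e0 x).val < h)
      (q := fun i => i.val < h) (fun _ => Iff.rfl)).symm
    apply Fintype.equivOfCardEq
    rw [Fintype.card_coe, hA, Fintype.card_subtype]
    have : (Finset.univ.filter (fun i : Fin (Fintype.card V) => i.val < h)) =
        (Finset.univ : Finset (Fin h)).map (Fin.castLEEmb hle) := by
      ext i
      simp only [Finset.mem_filter, Finset.mem_univ, true_and, Finset.mem_map]
      exact ⟨fun hi => ⟨⟨i, hi⟩, rfl⟩, by rintro ⟨j, -, rfl⟩; exact j.2⟩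
    rw [this]; simp
  let e : V ≃ Fin (Fintype.card V) := e1.extendSubtype.trans e0
  have he : ∀ x ∈ A, (e x).val < h := fun x hx => e1.extendSubtype_mem x hx
  refine ⟨e.toEmbedding, fun a b hab => ?_⟩
  unfold Sgraph
  rw [SimpleGraph.fromRel_adj]
  refine ⟨fun h => hab.ne (e.injective h), ?_⟩
  rcases hG a b hab with h | h
  · exact Or.inl (he _ h)
  · exact Or.inr (he _ h)

theorem dichot {h : ℕ} (hh : 1 ≤ h) (hδ : ∀ v, h ≤ G.degree v) (hc : G.Connected)
    (hmax : ∀ q, ¬ PP G q (2 * h + 2))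
    (hn : 2 * h + 2 ≤ Fintype.card V)
    {p : ℕ → V} (hp : PP G p (2 * h + 1)) :
    (2 ≤ h ∧ ∃ q, CC G q (2 * h)) ∨
    (∀ x, G.Adj (p 0) x ↔ ∃ i, 1 ≤ i ∧ i ≤ h ∧ p i = x) := by
  obtain ⟨hcard, hor⟩ := (counts hδ hc hp (by omega) (by omega) hmax).2 rfl
  by_cases hB : ∃ i, i + 2 ≤ 2 * h ∧ G.Adj (p (2 * h)) (p i) ∧ G.Adj (p 0) (p (i + 2))
  · left
    obtain ⟨i, hi, h1, h2⟩ := hB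
    have hi0 : i ≠ 0 := by
      rintro rfl
      exact nocross hc hp (by omega) hmax (i := 0) (by omega) (hp.2 0 (by omega)) h1
    refine ⟨by omega, ?_⟩
    have hq : PP G (fun j => p (if j ≤ i then j else 2 * h + 1 + i - j)) (2 * h) := by
      refine hp.comp _ (fun j hj => by split_ifs <;> omega)
        (fun j l hj hl h => by split_ifs at h <;> omega) (fun j hj => ?_)
      by_cases hji : j = i
      · subst hji
        right; right
        simp only [le_refl, if_true, show ¬ j + 1 ≤ j by omega, if_false]
        rw [show 2 * h + 1 + j - (j + 1) = 2 * h by omega]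
        exact h1.symm
      · split_ifs <;> omega
    exact ⟨_, hq.cc (by omega) (by
      simp only [show ¬ 2 * h - 1 ≤ i by omega, if_false, Nat.zero_le, if_true]
      rw [show 2 * h + 1 + i - (2 * h - 1) = i + 2 by omega]
      exact h2.symm)⟩
  · right
    push Not at hB
    have step : ∀ i, i + 1 < 2 * h → G.Adj (p 0) (p (i + 1 + 1)) → G.Adj (p 0) (p (i + 1)) := by
      intro i hi h1
      rcases hor i (by omega) with h2 | h2
      · exact h2
      · exact absurd h1 (hB i (by omega) h2)
    have down : ∀ d i, i + d < 2 * h → G.Adj (p 0) (p (i + d + 1)) → G.Adj (p 0) (p (i + 1)) := by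
      intro d
      induction d with
      | zero => intro i _ h; exact h
      | succ d ih => intro i hi h; exact ih i (by omega) (step (i + d) (by omega) h)
    have key : ∀ i < 2 * h, (G.Adj (p 0) (p (i + 1)) ↔ i < h) := by
      intro i hi
      constructor
      · intro h1
        have : Finset.range (i + 1) ⊆
            (Finset.range (2 * h)).filter (fun i => G.Adj (p 0) (p (i + 1))) := by
          intro j hj
          simp only [Finset.mem_range, Finset.mem_filter] at hj ⊢
          refine ⟨by omega, down (i - j) j (by omega) ?_⟩
          rw [show j + (i - j) = i by omega]; exact h1
        have := Finset.card_le_card this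
        rw [Finset.card_range] at this
        omega
      · intro h1
        by_contra h2
        have : (Finset.range (2 * h)).filter (fun i => G.Adj (p 0) (p (i + 1))) ⊆
            Finset.range i := by
          intro j hj
          simp only [Finset.mem_range, Finset.mem_filter] at hj ⊢
          by_contra hji
          refine h2 (down (j - i) i (by omega) ?_)
          rw [show i + (j - i) = j by omega]; exact hj.2
        have := Finset.card_le_card this
        rw [Finset.card_range] at this
        omega
    intro x
    constructor
    · intro hx
      obtain ⟨i, hi, rfl⟩ := nbr_in hp hmax hx
      have : i ≠ 0 := by rintro rfl; exact G.loopless.irrefl _ hx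
      refine ⟨i, by omega, ?_, rfl⟩
      have := (key (i - 1) (by omega)).1 (by rw [show i - 1 + 1 = i by omega]; exact hx)
      omega
    · rintro ⟨i, h1, h2, rfl⟩
      have := (key (i - 1) (by omega)).2 (by omega)
      rwa [show i - 1 + 1 = i by omega] at this

def Star (G : SimpleGraph V) (h : ℕ) : Prop :=
  ∀ p, PP G p (2 * h + 1) → ∀ x, G.Adj (p 0) x ↔ ∃ i, 1 ≤ i ∧ i ≤ h ∧ p i = x

theorem clique {h : ℕ} (hS : Star G h) {p : ℕ → V} (hp : PP G p (2 * h + 1)) {l : ℕ} (hl : l < h)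
    (x : V) : G.Adj (p l) x ↔ ∃ i, i ≤ h ∧ i ≠ l ∧ p i = x := by
  have hq : PP G (fun i => p (if i ≤ l then l - i else i)) (2 * h + 1) := by
    refine hp.comp _ (fun j hj => by split_ifs <;> omega)
      (fun j l hj hl h => by split_ifs at h <;> omega) (fun j hj => ?_)
    by_cases hjl : j = l
    · subst hjl
      right; right
      simp only [le_refl, if_true, show ¬ j + 1 ≤ j by omega, if_false, Nat.sub_self]
      exact (hS p hp _).2 ⟨j + 1, by omega, by omega, rfl⟩
    · split_ifs <;> omega
  have := hS _ hq x
  simp only [Nat.zero_le, if_true, Nat.sub_zero] at this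
  rw [this]
  constructor
  · rintro ⟨i, h1, h2, h3⟩
    exact ⟨_, by split_ifs <;> omega, by split_ifs <;> omega, h3⟩
  · rintro ⟨i, h1, h2, h3⟩
    refine ⟨if i ≤ l then l - i else i, by split_ifs <;> omega, by split_ifs <;> omega, ?_⟩
    rw [← h3]
    congr 1
    split_ifs <;> omega

def InS (G : SimpleGraph V) (h : ℕ) (c u : V) : Prop :=
  u = c ∨ ∃ q, PP G q (2 * h + 1) ∧ q h = c ∧ ∃ l, l < h ∧ q l = u

theorem InS.nbr {h : ℕ} (hS : Star G h) {c u w : V} (hu : InS G h c u) (huc : u ≠ c)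
    (huw : G.Adj u w) : InS G h c w := by
  rcases hu with hu | ⟨q, hq, hqc, l, hl, rfl⟩
  · exact absurd hu huc
  obtain ⟨i, h1, h2, rfl⟩ := (clique hS hq hl w).1 huw
  by_cases hi : i = h
  · subst hi; exact Or.inl hqc
  · exact Or.inr ⟨q, hq, hqc, i, by omega, rfl⟩

theorem allS {h : ℕ} (hh : 1 ≤ h) (hδ : ∀ v, h ≤ G.degree v) (hc : G.Connected)
    (hS : Star G h) {p : ℕ → V} (hp : PP G p (2 * h + 1)) (u : V) : InS G h (p h) u := by
  by_contra hu
  obtain ⟨v, w, hv, hw, hvw⟩ := boundary hc (InS G h (p h)) (x := p h) (Or.inl rfl) hu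
  have hvc : v = p h := by
    by_contra hvc
    exact hw (hv.nbr hS hvc hvw)
  subst hvc
  have greedy : ∀ s, s + 1 ≤ h → ∃ r, PP G r (s + 1) ∧ r s = w ∧
      ∀ i ≤ s, ¬ InS G h (p h) (r i) := by
    intro s
    induction s with
    | zero =>
      intro _
      exact ⟨fun _ => w, ⟨fun i j hi hj _ => by omega, fun i hi => by omega⟩, rfl, fun _ _ => hw⟩
    | succ s ih =>
      intro hs
      obtain ⟨r, hr, hrs, hrn⟩ := ih (by omega)
      have : ∃ x, G.Adj (r 0) x ∧ x ≠ p h ∧ ∀ i < s + 1, r i ≠ x := by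
        by_contra! hcon
        have hsub : G.neighborFinset (r 0) ⊆
            insert (p h) ((Finset.range s).image (fun i => r (i + 1))) := by
          intro x hx
          rw [SimpleGraph.mem_neighborFinset] at hx
          rw [Finset.mem_insert]
          by_cases hxc : x = p h
          · exact Or.inl hxc
          · right
            obtain ⟨i, hi, rfl⟩ := hcon x hx hxc
            have : i ≠ 0 := by rintro rfl; exact G.loopless.irrefl _ hx
            exact Finset.mem_image.2 ⟨i - 1, by simp; omega,
              by simp only [show i - 1 + 1 = i by omega]⟩
        have c1 := Finset.card_le_card hsub
        have c2 := Finset.card_insert_le (p h) ((Finset.range s).image (fun i => r (i + 1)))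
        have c3 := Finset.card_image_le (s := Finset.range s) (f := fun i => r (i + 1))
        rw [G.card_neighborFinset_eq_degree] at c1
        rw [Finset.card_range] at c3
        have := hδ (r 0)
        omega
      obtain ⟨x, hx1, hx2, hx3⟩ := this
      refine ⟨cons x r, hr.cons hx3 hx1.symm, by simpa [cons] using hrs, ?_⟩
      intro i hi
      unfold cons
      split_ifs with h0
      · intro hx
        exact hrn 0 (by omega) (hx.nbr hS hx2 hx1.symm)
      · exact hrn _ (by omega)
  obtain ⟨r, hr, hrs, hrn⟩ := greedy (h - 1) (by omega)
  rw [show h - 1 + 1 = h by omega] at hr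
  have hpS : ∀ i ≤ h, InS G h (p h) (p i) := by
    intro i hi
    by_cases hih : i = h
    · subst hih; exact Or.inl rfl
    · exact Or.inr ⟨p, hp, rfl, i, by omega, rfl⟩
  refine hw (Or.inr ⟨fun i => if i < h then r i else if i = h then p h else p (i - h - 1),
    ⟨?_, ?_⟩, by simp, h - 1, by omega, by simp only [show h - 1 < h by omega, if_true]; exact hrs⟩)
  · intro i j hi hj hij
    have hne : ∀ i j, i < h → j ≤ h → r i ≠ p j := by
      intro i j hi hj h
      exact hrn i (by omega) (h ▸ hpS j hj)
    simp only at hij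
    split_ifs at hij with h1 h2 h3 h4 h5 h6 h7 h8
    · exact hr.1 _ _ (by omega) (by omega) hij
    · exact absurd hij (hne _ _ (by omega) (by omega))
    · exact absurd hij (hne _ _ (by omega) (by omega))
    · exact absurd hij.symm (hne _ _ (by omega) (by omega))
    · omega
    · have := hp.1 _ _ (by omega) (by omega) hij
      omega
    · exact absurd hij.symm (hne _ _ (by omega) (by omega))
    · have := hp.1 _ _ (by omega) (by omega) hij
      omega
    · have := hp.1 _ _ (by omega) (by omega) hij
      omega
  · intro i hi
    simp only
    by_cases h1 : i + 1 < h
    · simp only [h1, show i < h by omega, if_true]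
      exact hr.2 _ h1
    by_cases h2 : i + 1 = h
    · simp only [h2, show i < h by omega, if_true, lt_irrefl, if_false]
      rw [show i = h - 1 by omega, hrs]; exact hvw.symm
    by_cases h3 : i = h
    · subst h3
      simp only [lt_irrefl, if_false, if_true, show ¬ i + 1 < i by omega,
        show ¬ i + 1 = i by omega, show i + 1 - i - 1 = 0 by omega]
      exact ((clique hS hp (l := 0) (by omega) _).2 ⟨i, le_rfl, by omega, rfl⟩).symm
    · simp only [h1, show ¬ i < h by omega, h2, h3, if_false]
      have := hp.2 (i - h - 1) (by omega)
      rwa [show i - h - 1 + 1 = i + 1 - h - 1 by omega] at this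

theorem iso_L {h : ℕ} (hh : 1 ≤ h) (c : V) (h1 : ∀ u, u ≠ c → G.Adj c u)
    (h2 : ∀ u, u ≠ c → G.degree u = h)
    (h3 : ∀ u v w, u ≠ c → v ≠ c → w ≠ c → G.Adj u v → G.Adj v w → u = w ∨ G.Adj u w) :
    ∃ t, Fintype.card V = t * h + 1 ∧ Nonempty (G ≃g Lgen t 0 h) := by
  classical
  let s : Setoid {u : V // u ≠ c} :=
    { r := fun u v => u = v ∨ G.Adj u.1 v.1
      iseqv := by
        refine ⟨fun _ => Or.inl rfl, ?_, ?_⟩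
        · rintro x y (h | h)
          · exact Or.inl h.symm
          · exact Or.inr h.symm
        · rintro x y z (h | h) (h' | h')
          · exact Or.inl (h.trans h')
          · subst h; exact Or.inr h'
          · subst h'; exact Or.inr h
          · rcases h3 _ _ _ x.2 y.2 z.2 h h' with h | h
            · exact Or.inl (Subtype.ext h)
            · exact Or.inr h }
  let Q := Quotient s
  let t := Fintype.card Q
  let eQ : Q ≃ Fin t := Fintype.equivFin Q
  have hfib : ∀ k : Q, Nonempty ({u : {u : V // u ≠ c} // (Quotient.mk s u) = k} ≃ Fin h) := by
    intro k
    induction k using Quotient.inductionOn with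
    | h u =>
    refine ⟨Fintype.equivOfCardEq ?_⟩
    have e : {v : {u : V // u ≠ c} // (Quotient.mk s v) = Quotient.mk s u} ≃
        {v // v ∈ insert u.1 ((G.neighborFinset u.1).erase c)} :=
      { toFun := fun v => ⟨v.1.1, by
          have := Quotient.exact v.2
          rcases this with h | h
          · rw [h]; exact Finset.mem_insert_self _ _
          · refine Finset.mem_insert_of_mem (Finset.mem_erase.2 ⟨v.1.2, ?_⟩)
            rw [SimpleGraph.mem_neighborFinset]; exact h.symm⟩
        invFun := fun v => ⟨⟨v.1, by
          rcases Finset.mem_insert.1 v.2 with h | h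
          · rw [h]; exact u.2
          · exact (Finset.mem_erase.1 h).1⟩, by
          apply Quotient.sound
          rcases Finset.mem_insert.1 v.2 with h | h
          · exact Or.inl (Subtype.ext h)
          · have := (Finset.mem_erase.1 h).2
            rw [SimpleGraph.mem_neighborFinset] at this
            exact Or.inr this.symm⟩
        left_inv := fun v => rfl
        right_inv := fun v => rfl }
    rw [Fintype.card_congr e, Fintype.card_coe, Finset.card_insert_of_notMem (by simp),
      Finset.card_erase_of_mem (by
        rw [SimpleGraph.mem_neighborFinset]; exact (h1 _ u.2).symm),
      G.card_neighborFinset_eq_degree, h2 _ u.2, Fintype.card_fin]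
    omega
  let ef := fun k => (hfib k).some
  let E : {u : V // u ≠ c} ≃ Fin t × Fin h :=
    (Equiv.sigmaFiberEquiv (fun u => Quotient.mk s u)).symm.trans
      ((Equiv.sigmaCongrRight ef).trans ((Equiv.sigmaEquivProd Q (Fin h)).trans
        (Equiv.prodCongr eQ (Equiv.refl _))))
  have hE : ∀ u, (E u).1 = eQ (Quotient.mk s u) := fun u => rfl
  have hE' : ∀ u v, (E u).1 = (E v).1 ↔ u = v ∨ G.Adj u.1 v.1 := by
    intro u v
    rw [hE, hE, eQ.apply_eq_iff_eq]
    exact Quotient.eq (r := s)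
  have hcard : Fintype.card V = t * h + 1 := by
    rw [← Fintype.card_congr (Equiv.optionSubtypeNe c), Fintype.card_option, Fintype.card_congr E]
    simp
  refine ⟨t, hcard, ?_⟩
  let f : V → Fin (t * h + 0 * (h + 1) + 1) := fun v =>
    if hv : v = c then 0 else ⟨(finProdFinEquiv (E ⟨v, hv⟩)).val + 1, by
      have := (finProdFinEquiv (E ⟨v, hv⟩)).2
      omega⟩
  have fc : (f c).val = 0 := by simp [f]
  have fv : ∀ v (hv : v ≠ c), (f v).val = (finProdFinEquiv (E ⟨v, hv⟩)).val + 1 := by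
    intro v hv; simp [f, hv]
  have finj : Function.Injective f := by
    intro u v huv
    replace huv := congrArg Fin.val huv
    by_cases hu : u = c <;> by_cases hv : v = c
    · rw [hu, hv]
    · subst hu; rw [fc, fv v hv] at huv; omega
    · subst hv; rw [fc, fv u hu] at huv; omega
    · rw [fv v hv, fv u hu] at huv
      have := finProdFinEquiv.injective (Fin.ext (Nat.succ.inj huv))
      have := E.injective this
      exact congrArg Subtype.val this
  have fbij : Function.Bijective f := by
    rw [Fintype.bijective_iff_injective_and_card]
    exact ⟨finj, by rw [hcard]; simp⟩
  have blk : ∀ v (hv : v ≠ c), blockIdx t h (f v).val = (E ⟨v, hv⟩).1.val := by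
    intro v hv
    rw [fv v hv]
    unfold blockIdx
    rw [Nat.add_sub_cancel, if_pos (finProdFinEquiv (E ⟨v, hv⟩)).2]
    simp only [finProdFinEquiv_apply_val]
    rw [Nat.add_mul_div_left _ _ (by omega), Nat.div_eq_of_lt (E ⟨v, hv⟩).2.2, zero_add]
  refine ⟨⟨Equiv.ofBijective f fbij, ?_⟩⟩
  intro u v
  simp only [Equiv.ofBijective_apply]
  unfold Lgen
  rw [SimpleGraph.fromRel_adj]
  by_cases huv : u = v
  · subst huv; simp
  rw [finj.ne_iff]
  by_cases hu : u = c
  · subst hu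
    exact ⟨fun _ => h1 v (Ne.symm huv), fun _ => ⟨huv, Or.inl (Or.inl fc)⟩⟩
  by_cases hv : v = c
  · subst hv
    exact ⟨fun _ => (h1 u huv).symm, fun _ => ⟨huv, Or.inr (Or.inl fc)⟩⟩
  rw [blk u hu, blk v hv, fv u hu, fv v hv]
  have key := hE' ⟨u, hu⟩ ⟨v, hv⟩
  rw [Fin.ext_iff, Subtype.mk.injEq] at key
  constructor
  · rintro ⟨-, (h | h) | (h | h)⟩
    · omega
    · exact (key.1 h).resolve_left huv
    · omega
    · exact (key.1 h.symm).resolve_left huv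
  · intro h
    exact ⟨huv, Or.inl (Or.inr (key.2 (Or.inr h)))⟩


theorem forest {k : ℕ} (L : Fin k → ℕ) (P : ℕ → V) (N b : ℕ)
    (off : Fin k → ℕ) (hoff : ∀ i j, i < j → off i + L i ≤ off j) (hN : ∀ i, off i + L i ≤ N)
    (hb : ∀ i, off i + L i ≤ b ∨ b ≤ off i)
    (hinj : ∀ i j, i < N → j < N → P i = P j → i = j)
    (hadj : ∀ i, i + 1 < N → i + 1 ≠ b → G.Adj (P i) (P (i + 1))) :
    ContainsForest G L := by
  refine ⟨fun i x => P (off i + x.val), ?_, ?_, ?_⟩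
  · intro i x y hxy
    have := hN i
    have := hinj _ _ (by omega) (by omega) hxy
    exact Fin.ext (by omega)
  · intro i j hij x y hxy
    have := hN i
    have := hN j
    have := hinj _ _ (by omega) (by omega) hxy
    rcases lt_or_gt_of_ne hij with h | h
    · have := hoff _ _ h; omega
    · have := hoff _ _ h; omega
  · intro i x hx
    have := hN i
    exact hadj (off i + x) (by omega) (by have := hb i; omega)

end S15

theorem stmt_15 {V : Type*} [Fintype V] [DecidableEq V] (G : SimpleGraph V)
    [DecidableRel G.Adj] (h k : ℕ) (hh : 1 ≤ h) (hk : 2 ≤ k)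
    (a : Fin k → ℕ) (ha : Antitone a) (ha1 : ∀ i, 1 ≤ a i)
    (hsum : ∑ i, a i = h + 1)
    (hconn : G.Connected) (hcard : 2 * h + 2 ≤ Fintype.card V)
    (hδ : ∀ v, h ≤ G.degree v) :
    ContainsForest G (fun i => 2 * a i) ∨
    SubgraphOf G (Sgraph (Fintype.card V) h) ∨
    (k = 2 ∧ (∀ i j : Fin k, a i = a j) ∧
      ∃ t, Fintype.card V = t * h + 1 ∧ Nonempty (G ≃g Lgen t 0 h)) := by
  classical
  let off : Fin k → ℕ := fun i => ∑ j ∈ Finset.univ.filter (· < i), 2 * a j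
  have hoffs : ∀ i, off i + 2 * a i = ∑ j ∈ Finset.univ.filter (· ≤ i), 2 * a j := by
    intro i
    have : Finset.univ.filter (· ≤ i) = insert i (Finset.univ.filter (· < i)) := by
      ext j; simp [le_iff_eq_or_lt]
    rw [this, Finset.sum_insert (by simp)]
    exact add_comm _ _
  have hoff : ∀ i j, i < j → off i + 2 * a i ≤ off j := by
    intro i j hij
    rw [hoffs]
    refine Finset.sum_le_sum_of_subset ?_
    intro x hx
    simp only [Finset.mem_filter, Finset.mem_univ, true_and] at hx ⊢
    exact lt_of_le_of_lt hx hij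
  have hsum2 : ∑ i, 2 * a i = 2 * h + 2 := by rw [← Finset.mul_sum, hsum]; ring
  have hN : ∀ i, off i + 2 * a i ≤ 2 * h + 2 := by
    intro i
    rw [hoffs, ← hsum2]
    exact Finset.sum_le_sum_of_subset (Finset.filter_subset _ _)
  by_cases hmax : ∃ p, S15.PP G p (2 * h + 2)
  · obtain ⟨p, hp⟩ := hmax
    exact Or.inl (S15.forest _ p (2 * h + 2) 0 off hoff hN (fun _ => Or.inr (Nat.zero_le _)) hp.1
      (fun i hi _ => hp.2 i hi))
  push Not at hmax
  by_cases hcyc : 2 ≤ h ∧ ∃ q, S15.CC G q (2 * h)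
  · obtain ⟨h2, q, hq⟩ := hcyc
    obtain ⟨A, hA, hA'⟩ := S15.cyc_final h2 hδ hconn hmax hcard hq
    exact Or.inr (Or.inl (S15.sub_S A hA hA'))
  have hS : S15.Star G h := fun p hp =>
    (S15.dichot hh hδ hconn hmax hcard hp).resolve_left hcyc
  obtain ⟨p, hp⟩ := S15.exists_path hδ hconn hcard (2 * h + 1) le_rfl
  have hall : ∀ u, u ≠ p h → ∃ q, S15.PP G q (2 * h + 1) ∧ q h = p h ∧ ∃ l, l < h ∧ q l = u :=
    fun u hu => (S15.allS hh hδ hconn hS hp u).resolve_left hu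
  let z : Fin k := ⟨k - 1, by omega⟩
  have hz : ∀ i, i ≤ z := fun i => by
    have := i.2
    rw [Fin.le_def]; simp only [z]; omega
  by_cases hsmall : 2 * a z ≤ h
  · left
    obtain ⟨u, hu⟩ := S15.exists_outside p (m := 2 * h + 1) (by omega)
    obtain ⟨q, hq, hqc, l, hl, rfl⟩ := hall u (hu h (by omega)).symm
    have hdis : ∀ i j, i < h → j < 2 * h + 1 → q i ≠ p j := by
      intro i j hi hj hij
      have hadj : l = i ∨ G.Adj (q i) (q l) := by
        by_cases e : l = i
        · exact Or.inl e
        · exact Or.inr ((S15.clique hS hq hi _).2 ⟨l, by omega, e, rfl⟩)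
      rcases hadj with e | hadj
      · subst e; exact hu j hj hij.symm
      rcases lt_trichotomy j h with hjh | hjh | hjh
      · rw [hij] at hadj
        obtain ⟨x, hx, -, hx'⟩ := (S15.clique hS hp hjh _).1 hadj
        exact hu x (by omega) hx'
      · subst hjh
        have := hq.1 i j (by omega) (by omega) (hij.trans hqc.symm)
        omega
      · have := (S15.clique hS hp.rev (l := 2 * h - j) (by omega) (q l)).1 (by
          simp only [show 2 * h + 1 - 1 - (2 * h - j) = j by omega]
          rwa [← hij])
        obtain ⟨x, hx, -, hx'⟩ := this
        exact hu _ (by omega) hx'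
    have hb : off z + 2 * a z = 2 * h + 2 := by
      rw [hoffs, ← hsum2]
      refine Finset.sum_congr ?_ (fun _ _ => rfl)
      ext i; simp [hz i]
    have haz := ha1 z
    refine S15.forest _ (fun t => if t < off z then p t else q (t - off z)) (2 * h + 2) (off z)
      off hoff hN ?_ ?_ ?_
    · intro i
      rcases (hz i).eq_or_lt with e | e
      · right; rw [e]
      · left; exact hoff _ _ e
    · intro i j hi hj hij
      split_ifs at hij with h1 h2 h2
      · exact hp.1 _ _ (by omega) (by omega) hij
      · exact absurd hij.symm (hdis _ _ (by omega) (by omega))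
      · exact absurd hij (hdis _ _ (by omega) (by omega))
      · have := hq.1 _ _ (by omega) (by omega) hij
        omega
    · intro i hi hib
      by_cases h1 : i + 1 < off z
      · simp only [h1, show i < off z by omega, if_true]
        exact hp.2 _ (by omega)
      · simp only [h1, show ¬ i < off z by omega, if_false]
        have := hq.2 (i - off z) (by omega)
        rwa [show i - off z + 1 = i + 1 - off z by omega] at this
  · right; right
    have hge : ∀ i, h + 1 ≤ 2 * a i := fun i => by
      have := ha (hz i)
      omega
    have hk2 : k = 2 := by
      have : ∑ i : Fin k, (h + 1) ≤ ∑ i, 2 * a i := Finset.sum_le_sum (fun i _ => hge i)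
      rw [hsum2] at this
      simp only [Finset.sum_const, Finset.card_univ, Fintype.card_fin, smul_eq_mul] at this
      have : k ≤ 2 := by
        by_contra hk3
        have : 3 * (h + 1) ≤ k * (h + 1) := Nat.mul_le_mul_right _ (by omega)
        omega
      omega
    refine ⟨hk2, ?_, ?_⟩
    · subst hk2
      rw [Fin.sum_univ_two] at hsum
      have := hge 0
      have := hge 1
      have e : a 0 = a 1 := by omega
      intro i j
      fin_cases i <;> fin_cases j <;> simp [e]
    · refine S15.iso_L hh (p h) ?_ ?_ ?_
      · intro u hu
        obtain ⟨q, hq, hqc, l, hl, rfl⟩ := hall u hu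
        rw [← hqc]
        exact ((S15.clique hS hq hl _).2 ⟨h, le_rfl, by omega, rfl⟩).symm
      · intro u hu
        obtain ⟨q, hq, hqc, l, hl, rfl⟩ := hall u hu
        refine le_antisymm ?_ (hδ _)
        rw [← G.card_neighborFinset_eq_degree]
        have : G.neighborFinset (q l) ⊆ ((Finset.range (h + 1)).erase l).image q := by
          intro x hx
          rw [SimpleGraph.mem_neighborFinset] at hx
          obtain ⟨i, h1, h2, rfl⟩ := (S15.clique hS hq hl _).1 hx
          exact Finset.mem_image_of_mem _ (Finset.mem_erase.2 ⟨h2, by simp; omega⟩)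
        refine (Finset.card_le_card this).trans (Finset.card_image_le.trans ?_)
        rw [Finset.card_erase_of_mem (by simp; omega)]
        simp
      · intro u v w hu hv hw huv hvw
        obtain ⟨q, hq, hqc, l, hl, rfl⟩ := hall v hv
        obtain ⟨i, i1, i2, rfl⟩ := (S15.clique hS hq hl _).1 huv.symm
        obtain ⟨j, j1, j2, rfl⟩ := (S15.clique hS hq hl _).1 hvw
        by_cases hij : j = i
        · left; rw [hij]
        · right
          have : i ≠ h := by rintro rfl; exact hu hqc
          exact (S15.clique hS hq (by omega) _).2 ⟨j, j1, hij, rfl⟩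
end
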